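/- Let n, m, k be natural numbers with n < m and n ≤ k, let E ⊂ ℝ^k be an n-rectifiable set, and let D be any set with E ⊂ D ⊂ ℝ^k (for example D = ℝ^k). Then the set of functions f ∈ Lip_1(D, ℝ^m) satisfying H^n(f(E)) = H^n(E) is residual in Lip_1(D, ℝ^m). -/

import Mathlib

open MeasureTheory Metric Set Filter Topology ENNReal

noncomputable section

abbrev Euc (n : ℕ) : Type := EuclideanSpace ℝ (Fin n)

/-- An `n`-rectifiable subset of a metric space: an `H^n`-measurable set which is, up to an
`H^n`-null set, covered by countably many Lipschitz images of subsets of `ℝ^n`. -/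
def IsRectifiable (n : ℕ) {X : Type*} [MetricSpace X] [MeasurableSpace X] [BorelSpace X]
    (E : Set X) : Prop :=
  NullMeasurableSet E μH[n] ∧
    ∃ (F : ℕ → Set (Euc n)) (f : ℕ → Euc n → X) (K : ℕ → NNReal),
      (∀ i, LipschitzOnWith (K i) (f i) (F i)) ∧
      μH[n] (E \ ⋃ i, f i '' F i) = 0

/-- The space of bounded `L`-Lipschitz functions `X → ℝ^m` with the supremum metric. -/
abbrev LipE (L : NNReal) (X : Type*) [MetricSpace X] (m : ℕ) :=
  {f : BoundedContinuousFunction X (Euc m) // LipschitzWith L ⇑f}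

section Kirszbraun

variable {X Y : Type*} [NormedAddCommGroup X] [InnerProductSpace ℝ X]
  [NormedAddCommGroup Y] [InnerProductSpace ℝ Y]

theorem sum_sum_mul_norm_sub_sq {ι : Type*} [Fintype ι] (c : ι → ℝ) (hc : ∑ i, c i = 1)
    (y : ι → Y) :
    ∑ i, ∑ j, c i * c j * ‖y i - y j‖ ^ 2 =
      2 * (∑ i, c i * ‖y i‖ ^ 2 - ‖∑ i, c i • y i‖ ^ 2) := by
  have h1 : ‖∑ i, c i • y i‖ ^ 2 = ∑ i, ∑ j, c i * c j * inner ℝ (y i) (y j) := by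
    rw [← real_inner_self_eq_norm_sq, sum_inner]
    refine Finset.sum_congr rfl fun i _ => ?_
    rw [inner_sum]
    refine Finset.sum_congr rfl fun j _ => ?_
    rw [real_inner_smul_left, real_inner_smul_right]; ring
  have h2 : ∑ i, ∑ j, c i * c j * ‖y i‖ ^ 2 = ∑ i, c i * ‖y i‖ ^ 2 := by
    refine Finset.sum_congr rfl fun i _ => ?_
    rw [← Finset.sum_mul, ← Finset.mul_sum, hc, mul_one]
  have h3 : ∑ i, ∑ j, c i * c j * ‖y j‖ ^ 2 = ∑ i, c i * ‖y i‖ ^ 2 := by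
    rw [Finset.sum_comm, ← h2]
    refine Finset.sum_congr rfl fun i _ => Finset.sum_congr rfl fun j _ => by ring
  have h4 : ∀ i j, c i * c j * ‖y i - y j‖ ^ 2 = c i * c j * ‖y i‖ ^ 2 + c i * c j * ‖y j‖ ^ 2
      - 2 * (c i * c j * inner ℝ (y i) (y j)) := by
    intro i j; rw [norm_sub_sq_real]; ring
  simp_rw [h4, Finset.sum_sub_distrib, Finset.sum_add_distrib, ← Finset.mul_sum]
  rw [h2, h3, ← h1]; ring

/-- Intersection property of balls in inner product spaces: if the centres are moved by a
nonexpansive map, finitely many balls with a common point still have a common point. -/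
theorem exists_forall_norm_sub_le_of_finite {ι : Type*} [Fintype ι] [Nonempty ι]
    (x : ι → X) (y : ι → Y) (h : ∀ i j, ‖y i - y j‖ ≤ ‖x i - x j‖) (p : X) :
    ∃ q : Y, ∀ i, ‖q - y i‖ ≤ ‖p - x i‖ := by
  classical
  let a : ι → ℝ := fun i => ‖x i - p‖ ^ 2
  let D : (ι → ℝ) → ℝ := fun c => ∑ i, c i * (‖y i‖ ^ 2 - a i) - ‖∑ i, c i • y i‖ ^ 2
  have hD : Continuous D := by fun_prop
  obtain ⟨c, hc, hmax⟩ := (isCompact_stdSimplex ℝ ι).exists_isMaxOn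
    ⟨_, single_mem_stdSimplex ℝ (Classical.arbitrary ι)⟩ hD.continuousOn
  have hc0 := hc.1
  have hc1 := hc.2
  have hDc : D c ≤ 0 := by
    have e1 := sum_sum_mul_norm_sub_sq c hc1 y
    have e2 := sum_sum_mul_norm_sub_sq c hc1 (fun i => x i - p)
    have e3 : ∑ i, ∑ j, c i * c j * ‖y i - y j‖ ^ 2 ≤
        ∑ i, ∑ j, c i * c j * ‖(x i - p) - (x j - p)‖ ^ 2 := by
      refine Finset.sum_le_sum fun i _ => Finset.sum_le_sum fun j _ => ?_
      have hi := hc0 i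
      have hj := hc0 j
      rw [sub_sub_sub_cancel_right]
      gcongr
      exact h i j
    have e4 : D c = ∑ i, c i * ‖y i‖ ^ 2 - ∑ i, c i * a i - ‖∑ i, c i • y i‖ ^ 2 := by
      simp only [D, mul_sub, Finset.sum_sub_distrib]
    have e5 : 0 ≤ ‖∑ i, c i • (x i - p)‖ ^ 2 := by positivity
    simp only [a] at e4
    linarith
  set q := ∑ i, c i • y i with hq
  refine ⟨q, fun i => ?_⟩
  have key : ∀ t ∈ Ioo (0 : ℝ) 1, (1 - t) * ‖q - y i‖ ^ 2 ≤ a i := by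
    intro t ht
    have hmem : (1 - t) • c + t • (Pi.single i 1 : ι → ℝ) ∈ stdSimplex ℝ ι :=
      convex_stdSimplex ℝ ι hc (single_mem_stdSimplex ℝ i) (by linarith [ht.2]) ht.1.le (by ring)
    have h1 : D ((1 - t) • c + t • (Pi.single i 1 : ι → ℝ)) ≤ D c := hmax hmem
    have h2 : ∑ j, ((1 - t) • c + t • (Pi.single i 1 : ι → ℝ)) j • y j = (1 - t) • q + t • y i := by
      simp only [Pi.add_apply, Pi.smul_apply, smul_eq_mul, add_smul, Finset.sum_add_distrib,
        mul_smul, ← Finset.smul_sum, hq]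
      congr 2
      simp [Pi.single_apply, ite_smul]
    have h3 : ∑ j, ((1 - t) • c + t • (Pi.single i 1 : ι → ℝ)) j * (‖y j‖ ^ 2 - a j) =
        (1 - t) * ∑ j, c j * (‖y j‖ ^ 2 - a j) + t * (‖y i‖ ^ 2 - a i) := by
      simp only [Pi.add_apply, Pi.smul_apply, smul_eq_mul, add_mul, Finset.sum_add_distrib,
        mul_assoc, ← Finset.mul_sum]
      congr 2
      simp [Pi.single_apply]
    have h4 : ‖(1 - t) • q + t • y i‖ ^ 2 =
        (1 - t) * ‖q‖ ^ 2 + t * ‖y i‖ ^ 2 - t * (1 - t) * ‖q - y i‖ ^ 2 := by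
      rw [norm_add_sq_real, norm_sub_sq_real, norm_smul, norm_smul, real_inner_smul_left,
        real_inner_smul_right, mul_pow, mul_pow]
      simp only [Real.norm_eq_abs, sq_abs]
      ring
    simp only [D] at h1
    rw [h2, h3, h4, ← hq] at h1
    have h5 : D c = ∑ j, c j * (‖y j‖ ^ 2 - a j) - ‖q‖ ^ 2 := rfl
    have h6 : t * ((1 - t) * ‖q - y i‖ ^ 2 - a i) ≤ t * 0 := by nlinarith [ht.1]
    linarith [le_of_mul_le_mul_left h6 ht.1]
  have hlim : ‖q - y i‖ ^ 2 ≤ a i := by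
    have ht : Tendsto (fun t : ℝ => (1 - t) * ‖q - y i‖ ^ 2) (𝓝[>] 0)
        (𝓝 ((1 - 0) * ‖q - y i‖ ^ 2)) :=
      ((continuous_const.sub continuous_id).mul continuous_const).continuousAt.tendsto.mono_left
        nhdsWithin_le_nhds
    have := le_of_tendsto ht (Filter.mem_of_superset (Ioo_mem_nhdsGT one_pos) key)
    simpa using this
  rw [norm_sub_rev p]
  exact (sq_le_sq₀ (norm_nonneg _) (norm_nonneg _)).1 hlim

/-- Kirszbraun's theorem. -/
theorem exists_lipschitzWith_one_extension [FiniteDimensional ℝ Y] (f : X → Y) (A : Set X)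
    (hf : LipschitzOnWith 1 f A) : ∃ g : X → Y, LipschitzWith 1 g ∧ EqOn f g A := by
  classical
  let P : Set (X × Y) → Prop := fun Γ => ∀ u ∈ Γ, ∀ v ∈ Γ, ‖u.2 - v.2‖ ≤ ‖u.1 - v.1‖
  have hA : P ((fun a => (a, f a)) '' A) := by
    rintro _ ⟨a, ha, rfl⟩ _ ⟨b, hb, rfl⟩
    simpa [dist_eq_norm] using hf.dist_le_mul a ha b hb
  obtain ⟨Γ, hAΓ, hΓ⟩ := zorn_subset_nonempty {Γ | P Γ} (by
    intro C hC hchain _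
    refine ⟨⋃₀ C, ?_, fun s hs => subset_sUnion_of_mem hs⟩
    rintro u ⟨s, hs, hus⟩ v ⟨t, ht, hvt⟩
    rcases hchain.total hs ht with h | h
    · exact hC ht u (h hus) v hvt
    · exact hC hs u hus v (h hvt)) _ hA
  have hPΓ : P Γ := hΓ.prop
  have hex : ∀ p : X, ∃ q : Y, (p, q) ∈ Γ := by
    intro p
    obtain ⟨q, hq⟩ : ∃ q : Y, ∀ u ∈ Γ, ‖q - u.2‖ ≤ ‖p - u.1‖ := by
      rcases Γ.eq_empty_or_nonempty with rfl | ⟨u₀, hu₀⟩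
      · exact ⟨0, by simp⟩
      have hcomp : IsCompact (closedBall u₀.2 ‖p - u₀.1‖) := isCompact_closedBall _ _
      obtain ⟨q, -, hq⟩ := hcomp.inter_iInter_nonempty
        (fun u : Γ => closedBall (u : X × Y).2 ‖p - (u : X × Y).1‖)
        (fun u => isClosed_closedBall) (by
          intro s
          let s' : Finset Γ := insert ⟨u₀, hu₀⟩ s
          have : Nonempty s' := ⟨⟨⟨u₀, hu₀⟩, Finset.mem_insert_self _ _⟩⟩
          obtain ⟨q, hq⟩ := exists_forall_norm_sub_le_of_finite
            (fun i : s' => ((i : Γ) : X × Y).1) (fun i : s' => ((i : Γ) : X × Y).2)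
            (fun i j => hPΓ _ i.1.2 _ j.1.2) p
          refine ⟨q, ?_, ?_⟩
          · rw [mem_closedBall, dist_eq_norm]
            exact hq ⟨⟨u₀, hu₀⟩, Finset.mem_insert_self _ _⟩
          · simp only [mem_iInter, mem_closedBall, dist_eq_norm]
            intro u hu
            exact hq ⟨u, Finset.mem_insert_of_mem hu⟩)
      refine ⟨q, fun u hu => ?_⟩
      have := mem_iInter.1 hq ⟨u, hu⟩
      rwa [mem_closedBall, dist_eq_norm] at this
    refine ⟨q, ?_⟩
    have hP' : P (insert (p, q) Γ) := by
      rintro u (rfl | hu) v (rfl | hv)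
      · simp
      · exact hq v hv
      · rw [norm_sub_rev, norm_sub_rev u.1]; exact hq u hu
      · exact hPΓ u hu v hv
    exact hΓ.le_of_ge hP' (subset_insert _ _) (mem_insert _ _)
  choose g hg using hex
  refine ⟨g, LipschitzWith.of_dist_le_mul fun x y => ?_, fun a ha => ?_⟩
  · simpa [dist_eq_norm] using hPΓ _ (hg x) _ (hg y)
  · have := hPΓ _ (hAΓ ⟨a, ha, rfl⟩) _ (hg a)
    simpa [sub_eq_zero] using this

end Kirszbraun

instance isAddHaarMeasure_hausdorffMeasure_euc (n : ℕ) :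
    (μH[n] : Measure (Euc n)).IsAddHaarMeasure := by
  have h : Module.finrank ℝ (Euc n) = n := finrank_euclideanSpace_fin
  have := isAddHaarMeasure_hausdorffMeasure (E := Euc n)
  rwa [h] at this

theorem LipschitzOnWith.hausdorffMeasure_image_eq_zero {X Y : Type*} [EMetricSpace X]
    [EMetricSpace Y] [MeasurableSpace X] [BorelSpace X] [MeasurableSpace Y] [BorelSpace Y]
    {K : NNReal} {f : X → Y} {s : Set X} (h : LipschitzOnWith K f s) {n : ℕ}
    (hs : μH[n] s = 0) : μH[n] (f '' s) = 0 := by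
  have := h.hausdorffMeasure_image_le (d := n) (by positivity)
  rwa [hs, mul_zero, nonpos_iff_eq_zero] at this

section Brouwer

theorem exists_det_one_add_eq_sum {n : ℕ} (t : Fin (n + 1) → ℝ) (ht : Function.Injective t) :
    ∃ w : Fin (n + 1) → ℝ, ∑ j, w j = 1 ∧ ∀ A : Euc n →L[ℝ] Euc n,
      (1 + A).det = ∑ j, w j * (1 + t j • A).det := by
  classical
  refine ⟨fun j => (Lagrange.basis Finset.univ t j).eval 1, ?_, fun A => ?_⟩
  · rw [← Polynomial.eval_finsetSum, Lagrange.sum_basis ht.injOn Finset.univ_nonempty,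
      Polynomial.eval_one]
  · let b := (EuclideanSpace.basisFun (Fin n) ℝ).toBasis
    let M := LinearMap.toMatrix b b (A : Euc n →ₗ[ℝ] Euc n)
    let P : Polynomial ℝ := Matrix.det ((Polynomial.X : Polynomial ℝ) • M.map Polynomial.C +
      (1 : Matrix (Fin n) (Fin n) ℝ).map Polynomial.C)
    have hP : ∀ s : ℝ, P.eval s = (1 + s • A).det := by
      intro s
      have : (1 + s • A).det = Matrix.det (1 + s • M) := by
        rw [ContinuousLinearMap.det, ← LinearMap.det_toMatrix b]
        congr 1
        simp only [ContinuousLinearMap.toLinearMap_add, ContinuousLinearMap.toLinearMap_smul,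
          map_add, map_smul]
        congr 1
        exact LinearMap.toMatrix_one b
      rw [this, add_comm]
      simp only [P]
      rw [← Polynomial.coe_evalRingHom, RingHom.map_det]
      congr 1
      ext i j
      by_cases hij : i = j <;> simp [hij, mul_comm s]
    have hdeg : P.degree < (Finset.univ : Finset (Fin (n + 1))).card := by
      refine lt_of_le_of_lt Polynomial.degree_le_natDegree ?_
      have := Polynomial.natDegree_det_X_add_C_le M 1
      rw [Fintype.card_fin] at this
      rw [Finset.card_univ, Fintype.card_fin]
      exact_mod_cast Nat.lt_succ_of_le this
    have h1 := Lagrange.eq_interpolate ht.injOn hdeg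
    have h2 := hP 1
    rw [one_smul] at h2
    rw [← h2, h1, Lagrange.interpolate_apply, Polynomial.eval_finsetSum]
    refine Finset.sum_congr rfl fun j _ => ?_
    rw [Polynomial.eval_mul, Polynomial.eval_C, hP, mul_comm]

theorem exists_pos_forall_det_one_add_pos (n : ℕ) :
    ∃ ε > 0, ∀ A : Euc n →L[ℝ] Euc n, ‖A‖ < ε → 0 < (1 + A).det := by
  have hc : Continuous fun A : Euc n →L[ℝ] Euc n => (1 + A).det :=
    ContinuousLinearMap.continuous_det.comp (continuous_const.add continuous_id)
  have h0 : (0 : ℝ) < (1 + (0 : Euc n →L[ℝ] Euc n)).det := by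
    rw [add_zero]
    have : (1 : Euc n →L[ℝ] Euc n).det = 1 := LinearMap.det_id
    rw [this]; exact one_pos
  obtain ⟨ε, hε, h⟩ := Metric.eventually_nhds_iff.1
    (hc.continuousAt.eventually (lt_mem_nhds h0))
  exact ⟨ε, hε, fun A hA => h (by simpa using hA)⟩

/-- A small Lipschitz perturbation of the identity, supported in the unit ball and mapping the
ball to itself, is a bijection of the ball. -/
theorem injective_and_image_ball_add_smul {n : ℕ} {h : Euc n → Euc n} {L : NNReal}
    (hL : LipschitzWith L h) (hout : ∀ x, 1 ≤ ‖x‖ → h x = 0) (hin : ∀ x, ‖x‖ < 1 → ‖x + h x‖ ≤ 1)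
    {t : ℝ} (ht0 : 0 < t) (ht1 : t < 1) (htL : t * L < 1) :
    Function.Injective (fun x => x + t • h x) ∧
      (fun x => x + t • h x) '' ball 0 1 = ball 0 1 := by
  have hlip : ∀ x y, ‖t • h x - t • h y‖ ≤ t * L * ‖x - y‖ := by
    intro x y
    rw [← smul_sub, norm_smul, Real.norm_of_nonneg ht0.le, mul_assoc]
    gcongr
    simpa [dist_eq_norm] using hL.dist_le_mul x y
  refine ⟨fun x y hxy => ?_, ?_⟩
  · have h1 : x - y = -(t • h x - t • h y) := by
      simp only at hxy
      rw [neg_sub, sub_eq_sub_iff_add_eq_add, hxy, add_comm]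
    have h2 := hlip x y
    rw [← norm_neg, ← h1] at h2
    have h3 : ‖x - y‖ ≤ 0 := by
      by_contra hcon
      push Not at hcon
      nlinarith
    exact sub_eq_zero.1 (norm_le_zero_iff.1 h3)
  · apply Subset.antisymm
    · rintro _ ⟨x, hx, rfl⟩
      rw [mem_ball_zero_iff] at hx ⊢
      have : x + t • h x = (1 - t) • x + t • (x + h x) := by module
      dsimp only
      rw [this]
      calc ‖(1 - t) • x + t • (x + h x)‖ ≤ ‖(1 - t) • x‖ + ‖t • (x + h x)‖ := norm_add_le _ _
        _ = (1 - t) * ‖x‖ + t * ‖x + h x‖ := by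
          rw [norm_smul, norm_smul, Real.norm_of_nonneg ht0.le,
            Real.norm_of_nonneg (by linarith)]
        _ < 1 := by nlinarith [hin x hx]
    · intro y hy
      have hcon : ContractingWith (Real.toNNReal t * L) (fun x => y - t • h x) := by
        refine ⟨?_, LipschitzWith.of_dist_le_mul fun a b => ?_⟩
        · rw [← NNReal.coe_lt_coe, NNReal.coe_mul, Real.coe_toNNReal t ht0.le]
          exact htL
        have : y - t • h a - (y - t • h b) = -(t • h a - t • h b) := by abel
        rw [dist_eq_norm, dist_eq_norm, this, norm_neg, NNReal.coe_mul, Real.coe_toNNReal t ht0.le]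
        exact hlip a b
      have hfix : y - t • h hcon.fixedPoint = hcon.fixedPoint := hcon.fixedPoint_isFixedPt
      set x := ContractingWith.fixedPoint _ hcon
      have hxy : x + t • h x = y := (sub_eq_iff_eq_add.1 hfix).symm
      refine ⟨x, ?_, hxy⟩
      rw [mem_ball_zero_iff] at hy ⊢
      by_contra hcon'
      push Not at hcon'
      rw [hout x hcon', smul_zero, add_zero] at hxy
      rw [hxy] at hcon'
      linarith

/-- There is no Lipschitz retraction of a ball onto its boundary sphere. -/
theorem no_lipschitz_retraction {n : ℕ} {R : Euc n → Euc n} {K : NNReal} (hR : LipschitzWith K R)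
    (hout : ∀ x, 1 ≤ ‖x‖ → R x = x) (hin : ∀ x, ‖x‖ < 1 → ‖R x‖ = 1) : False := by
  let μ : Measure (Euc n) := μH[n]
  let h : Euc n → Euc n := fun x => R x - x
  have hL : LipschitzWith (K + 1) h := hR.sub LipschitzWith.id
  let B : Set (Euc n) := ball 0 1
  let S : Set (Euc n) := B ∩ {x | DifferentiableAt ℝ h x}
  have hSmeas : MeasurableSet S := measurableSet_ball.inter (measurableSet_of_differentiableAt ℝ h)
  have hae : ∀ᵐ x ∂μ, DifferentiableAt ℝ h x := hL.ae_differentiableAt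
  have hSB : S =ᵐ[μ] B := by
    filter_upwards [hae] with x hx
    exact propext ⟨fun hx' => hx'.1, fun hx' => ⟨hx', hx⟩⟩
  have hnorm : ∀ x, ‖fderiv ℝ h x‖ ≤ K + 1 := fun x => by
    simpa using norm_fderiv_le_of_lipschitz ℝ hL (x₀ := x)
  obtain ⟨ε, hε, hdet⟩ := exists_pos_forall_det_one_add_pos n
  have hK : (0 : ℝ) < K + 1 := by positivity
  obtain ⟨t₀, ht₀, ht₀'⟩ : ∃ t₀ > 0, t₀ < min (1 / 2 : ℝ) (min (1 / (K + 1)) (ε / (K + 1))) :=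
    exists_between (by positivity)
  simp only [lt_min_iff, lt_div_iff₀ hK] at ht₀'
  let t : Fin (n + 1) → ℝ := fun j => t₀ / (j + 1)
  have ht_pos : ∀ j, 0 < t j := fun j => by positivity
  have ht_le : ∀ j, t j ≤ t₀ := fun j => div_le_self ht₀.le (by simp)
  have ht_inj : Function.Injective t := by
    intro i j hij
    simp only [t] at hij
    field_simp at hij
    exact Fin.ext (by exact_mod_cast (add_right_cancel hij).symm)
  obtain ⟨w, hw, hsum⟩ := exists_det_one_add_eq_sum t ht_inj
  have hmeas : ∀ j, Measurable fun x => (1 + t j • fderiv ℝ h x).det := fun j =>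
    ContinuousLinearMap.continuous_det.measurable.comp
      (measurable_const.add ((measurable_fderiv ℝ h).const_smul (t j)))
  have hlint : ∀ j, ∫⁻ x in S, ENNReal.ofReal |(1 + t j • fderiv ℝ h x).det| ∂μ = μ B := by
    intro j
    have htK : t j * ((K + 1 : NNReal) : ℝ) < 1 := by
      push_cast
      nlinarith [ht_le j]
    obtain ⟨hinj, himg⟩ := injective_and_image_ball_add_smul hL (fun x hx => by simp [h, hout x hx])
      (fun x hx => by simp [h, hin x hx]) (ht_pos j) (by linarith [ht_le j]) htK
    have hder : ∀ x ∈ S, HasFDerivWithinAt (fun x => x + t j • h x)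
        (1 + t j • fderiv ℝ h x) S x := fun x hx =>
      ((hasFDerivAt_id x).add (hx.2.hasFDerivAt.const_smul (t j))).hasFDerivWithinAt
    rw [lintegral_abs_det_fderiv_eq_addHaar_image μ hSmeas hder hinj.injOn]
    apply le_antisymm
    · refine le_of_le_of_eq ?_ (congrArg μH[n] himg)
      exact measure_mono (image_mono inter_subset_left)
    · have hT : LipschitzWith (1 + ‖t j‖₊ * (K + 1)) (fun x => x + t j • h x) :=
        LipschitzWith.id.add ((lipschitzWith_smul (t j)).comp hL)
      have hnull : μ ((fun x => x + t j • h x) '' (B \ S)) = 0 := by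
        refine hT.lipschitzOnWith.hausdorffMeasure_image_eq_zero ?_
        exact measure_mono_null (fun x hx hd => hx.2 ⟨hx.1, hd⟩) hae
      calc μ B = μ ((fun x => x + t j • h x) '' B) := congrArg μ himg.symm
        _ ≤ μ ((fun x => x + t j • h x) '' S ∪ (fun x => x + t j • h x) '' (B \ S)) := by
          rw [← image_union]
          exact measure_mono (image_mono (by simp))
        _ ≤ _ := (measure_union_le _ _).trans (by rw [hnull, add_zero])
  have hintegrable : ∀ j, IntegrableOn (fun x => (1 + t j • fderiv ℝ h x).det) S μ := by
    intro j
    refine ⟨(hmeas j).aestronglyMeasurable, ?_⟩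
    rw [hasFiniteIntegral_iff_norm]
    simp only [Real.norm_eq_abs]
    rw [hlint j]
    exact measure_ball_lt_top
  have hreal : ∀ j, ∫ x in S, (1 + t j • fderiv ℝ h x).det ∂μ = μ.real B := by
    intro j
    have hpos : ∀ x, 0 < (1 + t j • fderiv ℝ h x).det := by
      intro x
      apply hdet
      rw [norm_smul, Real.norm_of_nonneg (ht_pos j).le]
      calc t j * ‖fderiv ℝ h x‖ ≤ t₀ * (K + 1) := by
            gcongr
            · exact ht_le j
            · exact hnorm x
        _ < ε := ht₀'.2.2
    rw [integral_eq_lintegral_of_nonneg_ae (ae_of_all _ fun x => (hpos x).le)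
      (hmeas j).aestronglyMeasurable, Measure.real, ← hlint j]
    congr 2
    ext x
    rw [abs_of_pos (hpos x)]
  have hzero : ∀ x ∈ S, ∑ j, w j * (1 + t j • fderiv ℝ h x).det = 0 := by
    intro x hx
    rw [← hsum]
    have hRd : HasFDerivAt R (1 + fderiv ℝ h x) x := by
      have := (hasFDerivAt_id x).add hx.2.hasFDerivAt
      refine this.congr_of_eventuallyEq (Eventually.of_forall fun y => ?_)
      simp [h]
    have hxB : ‖x‖ < 1 := by simpa [B] using hx.1
    by_contra hne
    obtain ⟨v, hv⟩ := ((1 + fderiv ℝ h x).toContinuousLinearEquivOfDetNeZero hne).surjective (R x)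
    rw [ContinuousLinearMap.toContinuousLinearEquivOfDetNeZero_apply] at hv
    have hconst : HasFDerivAt (fun y => ‖R y‖ ^ 2) (0 : Euc n →L[ℝ] ℝ) x := by
      refine (hasFDerivAt_const (1 : ℝ) x).congr_of_eventuallyEq ?_
      filter_upwards [isOpen_ball.mem_nhds hx.1] with y hy
      rw [hin y (by simpa [B] using hy), one_pow]
    have hsq := hRd.norm_sq
    have h0 : (2 • ((innerSL ℝ) (R x)).comp (1 + fderiv ℝ h x)) v = 0 := by
      rw [hsq.unique hconst, zero_apply]
    rw [smul_apply, ContinuousLinearMap.comp_apply, hv, innerSL_apply_apply,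
      real_inner_self_eq_norm_sq, hin x hxB] at h0
    norm_num at h0
  have hfin : ∫ x in S, ∑ j, w j * (1 + t j • fderiv ℝ h x).det ∂μ = μ.real B := by
    rw [integral_finsetSum _ fun j _ => (hintegrable j).const_mul (w j)]
    simp_rw [integral_const_mul, hreal, ← Finset.sum_mul, hw, one_mul]
  rw [setIntegral_congr_fun hSmeas hzero, integral_zero] at hfin
  have : 0 < μ.real B := ENNReal.toReal_pos (measure_ball_pos _ _ one_pos).ne'
    measure_ball_lt_top.ne
  linarith

end Brouwer

section Surjective

theorem lipschitzWith_inv_max_norm_smul {V : Type*} [NormedAddCommGroup V] [NormedSpace ℝ V]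
    {c : ℝ} (hc : 0 < c) :
    LipschitzWith (2 / c).toNNReal fun x : V => (max c ‖x‖)⁻¹ • x := by
  refine LipschitzWith.of_dist_le_mul fun x y => ?_
  rw [Real.coe_toNNReal _ (by positivity), dist_eq_norm, dist_eq_norm]
  set a := max c ‖x‖
  set b := max c ‖y‖
  have ha : c ≤ a := le_max_left _ _
  have hb : c ≤ b := le_max_left _ _
  have hyb : ‖y‖ ≤ b := le_max_right _ _
  have ha0 : 0 < a := hc.trans_le ha
  have hb0 : 0 < b := hc.trans_le hb
  have hab : |b - a| ≤ ‖x - y‖ := by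
    rw [abs_sub_comm]
    exact (abs_max_sub_max_le_max c ‖x‖ c ‖y‖).trans
      (by simpa using abs_norm_sub_norm_le x y)
  have h : a⁻¹ • x - b⁻¹ • y = a⁻¹ • (x - y) + ((b - a) * (a⁻¹ * b⁻¹)) • y := by
    have : (b - a) * (a⁻¹ * b⁻¹) = a⁻¹ - b⁻¹ := by field_simp
    rw [this]; module
  have h2 : ‖((b - a) * (a⁻¹ * b⁻¹)) • y‖ ≤ a⁻¹ * ‖x - y‖ := by
    rw [norm_smul, Real.norm_eq_abs, abs_mul, abs_of_pos (by positivity : 0 < a⁻¹ * b⁻¹)]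
    calc |b - a| * (a⁻¹ * b⁻¹) * ‖y‖ ≤ ‖x - y‖ * (a⁻¹ * b⁻¹) * b := by gcongr
      _ = a⁻¹ * ‖x - y‖ := by field_simp
  have h3 : a⁻¹ ≤ c⁻¹ := inv_anti₀ hc ha
  rw [h]
  refine (norm_add_le _ _).trans ?_
  rw [norm_smul, norm_inv, Real.norm_of_nonneg ha0.le]
  calc _ ≤ a⁻¹ * ‖x - y‖ + a⁻¹ * ‖x - y‖ := by gcongr
    _ ≤ c⁻¹ * ‖x - y‖ + c⁻¹ * ‖x - y‖ := by gcongr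
    _ = 2 / c * ‖x - y‖ := by ring

theorem zero_mem_range_id_add {n : ℕ} {h : Euc n → Euc n} {L : NNReal} (hL : LipschitzWith L h)
    (hb : ∀ x, ‖h x‖ ≤ 1 / 4) : ∃ x, x + h x = 0 := by
  by_contra! hne
  let χ : Euc n → ℝ := fun x => max 0 (min 1 (2 - 2 * ‖x‖))
  have hχ0 : ∀ x, 0 ≤ χ x := fun x => le_max_left _ _
  have hχ1 : ∀ x, χ x ≤ 1 := fun x => max_le zero_le_one (min_le_left _ _)
  have hχlip : ∀ x y, |χ x - χ y| ≤ 2 * ‖x - y‖ := by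
    intro x y
    refine (abs_max_sub_max_le_max _ _ _ _).trans ?_
    rw [sub_self, abs_zero, max_le_iff]
    refine ⟨by positivity, (abs_min_sub_min_le_max _ _ _ _).trans ?_⟩
    rw [sub_self, abs_zero, max_le_iff]
    refine ⟨by positivity, ?_⟩
    have : 2 - 2 * ‖x‖ - (2 - 2 * ‖y‖) = 2 * (‖y‖ - ‖x‖) := by ring
    rw [this, abs_mul, abs_two, norm_sub_rev]
    exact mul_le_mul_of_nonneg_left (abs_norm_sub_norm_le y x) zero_le_two
  let G : Euc n → Euc n := fun x => x + χ x • h x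
  have hG : LipschitzWith (1 + (L + 1)) G := by
    refine LipschitzWith.id.add (LipschitzWith.of_dist_le_mul fun x y => ?_)
    rw [dist_eq_norm, dist_eq_norm]
    have : χ x • h x - χ y • h y = χ x • (h x - h y) + (χ x - χ y) • h y := by module
    rw [this]
    refine (norm_add_le _ _).trans ?_
    rw [norm_smul, norm_smul, Real.norm_of_nonneg (hχ0 x), Real.norm_eq_abs]
    have h1 : ‖h x - h y‖ ≤ L * ‖x - y‖ := by simpa [dist_eq_norm] using hL.dist_le_mul x y
    calc _ ≤ 1 * (L * ‖x - y‖) + 2 * ‖x - y‖ * (1 / 4) := by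
          gcongr
          exacts [hχ1 x, hχlip x y, hb y]
      _ ≤ ((L + 1 : NNReal) : ℝ) * ‖x - y‖ := by
          push_cast
          nlinarith [norm_nonneg (x - y)]
  have hGne : ∀ x, G x ≠ 0 := by
    intro x
    rcases le_total ‖x‖ (1 / 2) with hx | hx
    · have : χ x = 1 := by
        simp only [χ]
        rw [min_eq_left (by linarith), max_eq_right zero_le_one]
      simpa [G, this] using hne x
    · intro h0
      have h1 : ‖x‖ = ‖χ x • h x‖ :=
        (congrArg norm (eq_neg_of_add_eq_zero_left h0)).trans (norm_neg _)
      rw [norm_smul, Real.norm_of_nonneg (hχ0 x)] at h1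
      nlinarith [hχ0 x, hχ1 x, hb x, norm_nonneg (h x)]
  have hGout : ∀ x, 1 ≤ ‖x‖ → G x = x := by
    intro x hx
    have : χ x = 0 := by
      simp only [χ]
      exact max_eq_left ((min_le_right _ _).trans (by linarith))
    simp [G, this]
  obtain ⟨c, hc, hcG⟩ : ∃ c > 0, ∀ x, c ≤ ‖G x‖ := by
    obtain ⟨x₀, -, hx₀⟩ := (isCompact_closedBall (0 : Euc n) 1).exists_isMinOn
      ⟨0, by simp⟩ hG.continuous.norm.continuousOn
    refine ⟨min ‖G x₀‖ 1, lt_min (norm_pos_iff.2 (hGne x₀)) one_pos, fun x => ?_⟩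
    rcases le_total ‖x‖ 1 with hx | hx
    · exact (min_le_left _ _).trans (hx₀ (by simpa using hx))
    · rw [hGout x hx]; exact (min_le_right _ _).trans hx
  have hR := (((lipschitzWith_inv_max_norm_smul hc).comp hG).add LipschitzWith.id).sub
    (lipschitzWith_inv_max_norm_smul (V := Euc n) one_pos)
  refine no_lipschitz_retraction hR (fun x hx => ?_) (fun x hx => ?_)
  · have hcx := hcG x
    simp only [Function.comp, id, hGout x hx] at hcx ⊢
    rw [max_eq_right hcx, max_eq_right hx]
    abel
  · simp only [Function.comp, id]
    rw [max_eq_right (hcG x), max_eq_left hx.le, inv_one, one_smul, add_sub_cancel_right,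
      norm_smul, norm_inv, norm_norm, inv_mul_cancel₀ (norm_ne_zero_iff.2 (hGne x))]

/-- A Lipschitz map at bounded distance from the identity is surjective. -/
theorem surjective_of_norm_sub_le {n : ℕ} {G : Euc n → Euc n} {L : NNReal} (hG : LipschitzWith L G)
    {r : ℝ} (hr : ∀ x, ‖G x - x‖ ≤ r) : Function.Surjective G := by
  intro y
  obtain ⟨s, hs, hsr⟩ : ∃ s > 0, r ≤ s * (1 / 4) :=
    ⟨4 * max r 1, by positivity, by linarith [le_max_left r 1]⟩
  let h : Euc n → Euc n := fun x => s⁻¹ • (G (y + s • x) - (y + s • x))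
  have hA : LipschitzWith (0 + ‖s‖₊) fun x : Euc n => y + s • x :=
    (LipschitzWith.const y).add (lipschitzWith_smul s)
  have hL := (lipschitzWith_smul s⁻¹ (β := Euc n)).comp ((hG.comp hA).sub hA)
  obtain ⟨x, hx⟩ := zero_mem_range_id_add (h := h) hL fun x => by
    simp only [h]
    rw [norm_smul, norm_inv, Real.norm_of_nonneg hs.le, inv_mul_le_iff₀ hs]
    exact (hr _).trans hsr
  refine ⟨y + s • x, ?_⟩
  have h2 : s • (x + h x) = 0 := by rw [hx, smul_zero]
  simp only [h] at h2
  rw [smul_add, smul_inv_smul₀ hs.ne', ← add_sub_assoc, sub_eq_zero, add_comm] at h2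
  exact add_right_cancel (b := s • x) h2

end Surjective

section Stability

theorem exists_pos_forall_hausdorffMeasure_le_image_add {n : ℕ} {Ω : Set (Euc n)}
    (hΩ : IsCompact Ω) (L : NNReal) {ε : ℝ≥0∞} (hε : ε ≠ 0) :
    ∃ r > 0, ∀ G : Euc n → Euc n, LipschitzOnWith L G Ω → (∀ x ∈ Ω, ‖G x - x‖ ≤ r) →
      μH[n] Ω ≤ μH[n] (G '' Ω) + ε := by
  let μ : Measure (Euc n) := μH[n]
  let M : NNReal := 1 + 2 * (lipschitzExtensionConstant (Euc n) * (L + 1))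
  have hM : ((M : ℝ≥0∞) ^ n) ≠ 0 := by positivity
  have hM' : ((M : ℝ≥0∞) ^ n) ≠ ∞ := ENNReal.pow_ne_top coe_ne_top
  have hδ : ε / (M : ℝ≥0∞) ^ n ≠ 0 := ENNReal.div_ne_zero.2 ⟨hε, hM'⟩
  have hlt : μ Ω < μ Ω + ε / (M : ℝ≥0∞) ^ n := ENNReal.lt_add_right hΩ.measure_lt_top.ne hδ
  obtain ⟨r, hr, hrμ⟩ : ∃ r > 0, μ (cthickening r Ω) < μ Ω + ε / (M : ℝ≥0∞) ^ n :=
    (((tendsto_measure_cthickening_of_isCompact hΩ).eventually (gt_mem_nhds hlt)).filter_mono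
      nhdsWithin_le_nhds |>.and (self_mem_nhdsWithin (s := Ioi (0 : ℝ)))).exists.imp
      fun _ h => ⟨h.2, h.1⟩
  refine ⟨r, hr, fun G hG hGr => ?_⟩
  have hsub : LipschitzOnWith (L + 1) (fun x => G x - x) Ω := hG.sub LipschitzWith.id.lipschitzOnWith
  obtain ⟨h, hh, hhΩ⟩ := hsub.extend_finite_dimension
  let G' : Euc n → Euc n := fun x => x + r • (max r ‖h x‖)⁻¹ • h x
  have hG' : LipschitzWith M G' := by
    refine LipschitzWith.id.add ?_
    convert! ((lipschitzWith_smul r).comp (lipschitzWith_inv_max_norm_smul hr)).comp hh using 1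
    congr 1
    apply NNReal.coe_injective
    push_cast
    rw [Real.coe_toNNReal _ (by positivity), Real.norm_of_nonneg hr.le]
    field_simp
  have hG'r : ∀ x, ‖G' x - x‖ ≤ r := by
    intro x
    simp only [G', add_sub_cancel_left]
    rw [norm_smul, norm_smul, norm_inv, Real.norm_of_nonneg hr.le,
      Real.norm_of_nonneg (hr.le.trans (le_max_left _ _))]
    refine mul_le_of_le_one_right hr.le ?_
    rw [inv_mul_le_iff₀ (hr.trans_le (le_max_left _ _)), mul_one]
    exact le_max_right _ _
  have hGG' : EqOn G' G Ω := by
    intro x hx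
    simp only [G', ← hhΩ hx]
    rw [max_eq_left (hGr x hx), smul_inv_smul₀ hr.ne', add_sub_cancel]
  have hcov : Ω ⊆ G' '' Ω ∪ G' '' (cthickening r Ω \ Ω) := by
    intro y hy
    obtain ⟨x, rfl⟩ := surjective_of_norm_sub_le hG' hG'r y
    rw [← image_union]
    refine mem_image_of_mem _ ?_
    rw [union_sdiff_cancel (self_subset_cthickening Ω)]
    refine mem_cthickening_of_dist_le x (G' x) r Ω hy ?_
    rw [dist_eq_norm, norm_sub_rev]
    exact hG'r x
  calc μ Ω ≤ μ (G' '' Ω) + μ (G' '' (cthickening r Ω \ Ω)) :=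
        (measure_mono hcov).trans (measure_union_le _ _)
    _ ≤ μ (G '' Ω) + (M : ℝ≥0∞) ^ n * (ε / (M : ℝ≥0∞) ^ n) := by
        rw [hGG'.image_eq]
        gcongr
        have h1 := hG'.lipschitzOnWith.hausdorffMeasure_image_le (d := n)
          (s := cthickening r Ω \ Ω) (by positivity)
        rw [ENNReal.rpow_natCast] at h1
        refine h1.trans ?_
        gcongr
        exact (measure_sdiff_lt_of_lt_add hΩ.measurableSet.nullMeasurableSet
          (self_subset_cthickening Ω) hΩ.measure_lt_top.ne hrμ).le
    _ = μ (G '' Ω) + ε := by rw [ENNReal.mul_div_cancel hM hM']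

/-- Lower semicontinuity of the measure of images: if `T ∘ F` is bilipschitz on the compact set
`K` for some linear contraction `T` onto `ℝⁿ`, then maps uniformly close to `F` have images of
almost as large measure. -/
theorem exists_pos_forall_le_hausdorffMeasure_image {n m : ℕ} {X : Type*} [MetricSpace X]
    [Nonempty X] [MeasurableSpace X] [BorelSpace X] {K : Set X} (hK : IsCompact K)
    {F : X → Euc m} (hF : LipschitzOnWith 1 F K) {T : Euc m →L[ℝ] Euc n} (hT : ‖T‖ ≤ 1)
    {θ : NNReal} (hθ0 : 0 < θ)
    (hθ : ∀ p ∈ K, ∀ q ∈ K, θ * dist p q ≤ ‖T (F p - F q)‖) {ε : ℝ≥0∞} (hε : ε ≠ 0) :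
    ∃ r > 0, ∀ G : X → Euc m, LipschitzOnWith 1 G K → (∀ x ∈ K, ‖G x - F x‖ ≤ r) →
      (θ : ℝ≥0∞) ^ n * μH[n] K ≤ μH[n] (G '' K) + ε := by
  have hT1 : LipschitzWith 1 T := T.lipschitz.weaken (by exact_mod_cast hT)
  have hTF : LipschitzOnWith 1 (fun x => T (F x)) K := by
    have := hT1.comp_lipschitzOnWith hF
    rwa [one_mul] at this
  have hΩ : IsCompact ((fun x => T (F x)) '' K) := hK.image_of_continuousOn hTF.continuousOn
  obtain ⟨r, hr, hG⟩ := exists_pos_forall_hausdorffMeasure_le_image_add hΩ (θ⁻¹) hε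
  refine ⟨r, hr, fun G hG1 hGr => ?_⟩
  have hdist : ∀ p ∈ K, ∀ q ∈ K, dist p q ≤ (θ⁻¹ : NNReal) * dist (T (F p)) (T (F q)) := by
    intro p hp q hq
    have := hθ p hp q hq
    rw [map_sub, ← dist_eq_norm] at this
    rwa [NNReal.coe_inv, le_inv_mul_iff₀ (by exact_mod_cast hθ0)]
  obtain ⟨S, hS⟩ : ∃ S : Euc n → X, ∀ p ∈ K, S (T (F p)) = p := by
    have hinj : InjOn (fun x => T (F x)) K := fun p hp q hq hpq => by
      have := hdist p hp q hq
      rw [show T (F p) = T (F q) from hpq, dist_self, mul_zero] at this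
      exact dist_le_zero.1 this
    exact ⟨Function.invFunOn (fun x => T (F x)) K, fun p hp => hinj.leftInvOn_invFunOn hp⟩
  have hSlip : LipschitzOnWith θ⁻¹ S ((fun x => T (F x)) '' K) := by
    refine LipschitzOnWith.of_dist_le_mul ?_
    rintro _ ⟨p, hp, rfl⟩ _ ⟨q, hq, rfl⟩
    rw [hS p hp, hS q hq]
    exact hdist p hp q hq
  have hSimg : S '' ((fun x => T (F x)) '' K) = K := by
    rw [image_image]
    exact (image_congr hS).trans (image_id' K)
  have h1 := hG (fun y => T (G (S y))) (by
    have := (hT1.comp_lipschitzOnWith hG1).comp hSlip (by rw [mapsTo_iff_image_subset, hSimg])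
    rwa [one_mul, one_mul] at this) (by
    rintro _ ⟨p, hp, rfl⟩
    simp only [hS p hp]
    rw [← map_sub]
    refine (T.le_of_opNorm_le hT _).trans ?_
    rw [one_mul]
    exact hGr p hp)
  have h2 : (fun y => T (G (S y))) '' ((fun x => T (F x)) '' K) = T '' (G '' K) := by
    rw [image_image, image_image]
    exact image_congr fun p hp => by rw [hS p hp]
  rw [h2] at h1
  have h3 : μH[n] (T '' (G '' K)) ≤ μH[n] (G '' K) := by
    simpa using hT1.lipschitzOnWith.hausdorffMeasure_image_le (d := n) (s := G '' K) (by positivity)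
  have h4 := hSlip.hausdorffMeasure_image_le (d := n) (by positivity)
  rw [hSimg, ENNReal.rpow_natCast, ENNReal.coe_inv hθ0.ne', ← ENNReal.inv_pow] at h4
  calc (θ : ℝ≥0∞) ^ n * μH[n] K
      ≤ (θ : ℝ≥0∞) ^ n * (((θ : ℝ≥0∞) ^ n)⁻¹ * μH[n] ((fun x => T (F x)) '' K)) := by gcongr
    _ = μH[n] ((fun x => T (F x)) '' K) := by
      rw [← mul_assoc, ENNReal.mul_inv_cancel, one_mul]
      · have : (θ : ℝ≥0∞) ≠ 0 := by exact_mod_cast hθ0.ne'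
        positivity
      · exact ENNReal.pow_ne_top coe_ne_top
    _ ≤ _ := h1.trans (by gcongr)

end Stability

section Sard

theorem hausdorffMeasure_image_le_of_dist_le {X Y Z : Type*} [MetricSpace X] [MetricSpace Y]
    [MeasurableSpace Y] [BorelSpace Y] [MetricSpace Z] [MeasurableSpace Z] [BorelSpace Z]
    {f : X → Y} {g : X → Z} {s : Set X} {C : NNReal}
    (h : ∀ x ∈ s, ∀ y ∈ s, dist (f x) (f y) ≤ C * dist (g x) (g y)) (n : ℕ) :
    μH[n] (f '' s) ≤ (C : ℝ≥0∞) ^ n * μH[n] (g '' s) := by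
  rcases s.eq_empty_or_nonempty with rfl | ⟨x₀, -⟩
  · simp
  have : Nonempty X := ⟨x₀⟩
  have hinv : ∀ x ∈ s, f (Function.invFunOn g s (g x)) = f x := by
    intro x hx
    have hgx : g x ∈ g '' s := mem_image_of_mem g hx
    have := h _ (Function.invFunOn_mem hgx) x hx
    rw [Function.invFunOn_eq hgx, dist_self, mul_zero] at this
    exact dist_le_zero.1 this
  have hL : LipschitzOnWith C (fun z => f (Function.invFunOn g s z)) (g '' s) := by
    refine LipschitzOnWith.of_dist_le_mul ?_
    rintro _ ⟨x, hx, rfl⟩ _ ⟨y, hy, rfl⟩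
    rw [hinv x hx, hinv y hy]
    exact h x hx y hy
  have := hL.hausdorffMeasure_image_le (d := n) (by positivity)
  rwa [image_image, image_congr hinv, ENNReal.rpow_natCast] at this

theorem exists_linearMap_det_eq_of_norm_eq_one {n : ℕ} {u : Euc n} (hu : ‖u‖ = 1) {ε : ℝ}
    (hε0 : 0 < ε) (hε1 : ε < 1) : ∃ T : Euc n →ₗ[ℝ] Euc n, LinearMap.det T = ε ∧
      (∀ z, ε * ‖z‖ ≤ ‖T z‖) ∧ ∀ z, ∃ c : ℝ, T z = z + c • u := by
  let f : Module.Dual ℝ (Euc n) := -((1 - ε) • (innerSL ℝ u : Euc n →ₗ[ℝ] ℝ))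
  have hf : ∀ z, f z = -((1 - ε) * inner ℝ u z) := fun z => rfl
  refine ⟨LinearMap.transvection f u, ?_, fun z => ?_, fun z => ⟨f z, rfl⟩⟩
  · rw [LinearMap.transvection.det, hf, real_inner_self_eq_norm_sq, hu]
    ring
  · have h1 : LinearMap.transvection f u z = z + f z • u := rfl
    refine le_of_sq_le_sq ?_ (norm_nonneg _)
    rw [h1, norm_add_sq_real, inner_smul_right, norm_smul, hu, hf, real_inner_comm, mul_one,
      Real.norm_eq_abs, sq_abs]
    have h2 : inner ℝ z u ^ 2 ≤ ‖z‖ ^ 2 := by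
      have := abs_real_inner_le_norm z u
      rw [hu, mul_one] at this
      exact sq_le_sq' (abs_le.1 this).1 (abs_le.1 this).2
    nlinarith [mul_le_mul_of_nonneg_left h2 (by nlinarith : 0 ≤ 1 - ε ^ 2)]

/-- The image under a Lipschitz map of the set where its derivative is not injective is null. -/
theorem LipschitzWith.hausdorffMeasure_image_not_injective_fderiv {n k : ℕ} {φ : Euc n → Euc k}
    {L : NNReal} (hφ : LipschitzWith L φ) :
    μH[n] (φ '' {x | DifferentiableAt ℝ φ x ∧ ¬ Function.Injective (fderiv ℝ φ x)}) = 0 := by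
  set s := {x | DifferentiableAt ℝ φ x ∧ ¬ Function.Injective (fderiv ℝ φ x)} with hs
  have hball : s = ⋃ R : ℕ, s ∩ closedBall 0 R := by
    rw [← inter_iUnion, iUnion_closedBall_nat, inter_univ]
  rw [hball, image_iUnion, measure_iUnion_null_iff]
  intro R
  rcases s.eq_empty_or_nonempty with h0 | hne
  · simp [h0]
  have key : ∀ ε : ℝ, 0 < ε → ε < 1 → μH[n] (φ '' (s ∩ closedBall 0 R)) ≤
      ENNReal.ofReal ε * (((L + 1 : NNReal) : ℝ≥0∞) ^ n * μH[n] (closedBall (0 : Euc n) R)) := by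
    intro ε hε0 hε1
    obtain ⟨t, A, ht, hst, hA, hAs⟩ :=
      exists_closed_cover_approximatesLinearOn_of_hasFDerivWithinAt φ s (fderiv ℝ φ)
        (fun x hx => hx.1.hasFDerivAt.hasFDerivWithinAt) (fun _ => ε.toNNReal)
        (fun _ => (Real.toNNReal_pos.2 hε0).ne')
    have hpiece : ∀ j, μH[n] (φ '' (s ∩ (disjointed t j ∩ closedBall 0 R))) ≤
        ((L + 1 : NNReal) : ℝ≥0∞) ^ n *
          (ENNReal.ofReal ε * μH[n] (disjointed t j ∩ closedBall (0 : Euc n) R)) := by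
      intro j
      obtain ⟨y, hy, hAy⟩ := hAs hne j
      obtain ⟨u, hu, hAu⟩ : ∃ u : Euc n, ‖u‖ = 1 ∧ A j u = 0 := by
        have := hy.2
        rw [← hAy, injective_iff_map_eq_zero] at this
        push Not at this
        obtain ⟨v, hv, hv0⟩ := this
        exact ⟨‖v‖⁻¹ • v, by
          rw [norm_smul, norm_inv, norm_norm, inv_mul_cancel₀ (norm_ne_zero_iff.2 hv0)],
          by rw [map_smul, hv, smul_zero]⟩
      have hAL : ‖A j‖ ≤ L := by
        rw [hAy]
        exact norm_fderiv_le_of_lipschitz ℝ hφ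
      obtain ⟨T, hTdet, hTε, hTu⟩ := exists_linearMap_det_eq_of_norm_eq_one hu hε0 hε1
      have h1 : ∀ x ∈ s ∩ (disjointed t j ∩ closedBall 0 R),
          ∀ y ∈ s ∩ (disjointed t j ∩ closedBall 0 R),
          dist (φ x) (φ y) ≤ (L + 1 : NNReal) * dist (T x) (T y) := by
        intro x hx y hy
        have h2 := (hA j) x ⟨hx.1, disjointed_le t j hx.2.1⟩ y ⟨hy.1, disjointed_le t j hy.2.1⟩
        rw [Real.coe_toNNReal _ hε0.le] at h2
        rw [dist_eq_norm, dist_eq_norm, ← map_sub]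
        obtain ⟨c, hc⟩ := hTu (x - y)
        have h3 : A j (x - y) = A j (T (x - y)) := by rw [hc, map_add, map_smul, hAu, smul_zero,
          add_zero]
        have h4 : ‖A j (x - y)‖ ≤ L * ‖T (x - y)‖ := by
          rw [h3]; exact (A j).le_of_opNorm_le hAL _
        calc ‖φ x - φ y‖ ≤ ‖φ x - φ y - A j (x - y)‖ + ‖A j (x - y)‖ := norm_le_norm_sub_add _ _
          _ ≤ ‖T (x - y)‖ + L * ‖T (x - y)‖ := add_le_add (h2.trans (hTε _)) h4
          _ = _ := by push_cast; ring
      refine (hausdorffMeasure_image_le_of_dist_le h1 n).trans ?_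
      gcongr
      refine (measure_mono (image_mono inter_subset_right)).trans ?_
      rw [Measure.addHaar_image_linearMap, hTdet, abs_of_pos hε0]
    calc μH[n] (φ '' (s ∩ closedBall 0 R))
        ≤ μH[n] (⋃ j, φ '' (s ∩ (disjointed t j ∩ closedBall 0 R))) := by
          rw [← image_iUnion, ← inter_iUnion, ← iUnion_inter, iUnion_disjointed]
          exact measure_mono (image_mono fun x hx => ⟨hx.1, hst hx.1, hx.2⟩)
      _ ≤ ∑' j, ((L + 1 : NNReal) : ℝ≥0∞) ^ n *
          (ENNReal.ofReal ε * μH[n] (disjointed t j ∩ closedBall (0 : Euc n) R)) :=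
          (measure_iUnion_le _).trans (ENNReal.tsum_le_tsum hpiece)
      _ = ((L + 1 : NNReal) : ℝ≥0∞) ^ n * (ENNReal.ofReal ε *
          μH[n] (⋃ j, disjointed t j ∩ closedBall (0 : Euc n) R)) := by
          rw [ENNReal.tsum_mul_left, ENNReal.tsum_mul_left, measure_iUnion]
          · intro i j hij
            exact ((disjoint_disjointed t) hij).mono inter_subset_left inter_subset_left
          · exact fun j => (MeasurableSet.disjointed (fun i => (ht i).measurableSet) j).inter
              isClosed_closedBall.measurableSet
      _ ≤ _ := by
          rw [mul_left_comm]
          gcongr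
          exact iUnion_subset fun j => inter_subset_right
  have hlim : Tendsto (fun ε : ℝ => ENNReal.ofReal ε *
      (((L + 1 : NNReal) : ℝ≥0∞) ^ n * μH[n] (closedBall (0 : Euc n) R))) (𝓝[>] 0) (𝓝 0) := by
    have h1 : Tendsto (fun ε : ℝ => ENNReal.ofReal ε) (𝓝[>] 0) (𝓝 0) := by
      have := ENNReal.continuous_ofReal.tendsto (0 : ℝ)
      rw [ENNReal.ofReal_zero] at this
      exact this.mono_left nhdsWithin_le_nhds
    have h2 := ENNReal.Tendsto.mul_const (b := ((L + 1 : NNReal) : ℝ≥0∞) ^ n *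
      μH[n] (closedBall (0 : Euc n) R)) h1 (Or.inr (ENNReal.mul_ne_top
        (ENNReal.pow_ne_top coe_ne_top) (measure_closedBall_lt_top).ne))
    rwa [zero_mul] at h2
  refine le_antisymm (ge_of_tendsto hlim ?_) zero_le
  filter_upwards [Ioo_mem_nhdsGT (zero_lt_one (α := ℝ))] with ε hε
  exact key ε hε.1 hε.2

end Sard

section Folding

theorem exists_zigzag {σ p : ℝ} (hσ0 : 0 ≤ σ) (hσ1 : σ ≤ 1) (hp : 0 < p) :
    ∃ (ψ : ℝ → ℝ) (C : ℤ × Bool → Set ℝ), (∀ t t', |ψ t - ψ t'| ≤ |t - t'|) ∧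
      (∀ t, |ψ t - σ * t| ≤ p) ∧ (∀ κ, IsClosed (C κ)) ∧ (∀ t, ∃ κ, t ∈ C κ) ∧
      ∀ κ, ∃ s : ℝ, s ^ 2 = 1 ∧ ∀ t ∈ C κ, ∀ t' ∈ C κ, ψ t - ψ t' = s * (t - t') := by
  let Z : ℝ → ℝ := fun t => σ * ⌊t⌋ + min (t - ⌊t⌋) (σ + 1 - (t - ⌊t⌋))
  have hZle : ∀ (t : ℝ) (k : ℤ), Z t ≤ σ * k + |t - k| := by
    intro t k
    have h1 := Int.floor_le t
    have h2 := Int.lt_floor_add_one t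
    rcases le_or_gt k ⌊t⌋ with hk | hk
    · have hk' : (k : ℝ) ≤ ⌊t⌋ := by exact_mod_cast hk
      have := min_le_left (t - ⌊t⌋) (σ + 1 - (t - ⌊t⌋))
      have h3 := le_abs_self (t - k)
      simp only [Z]
      nlinarith
    · have hk' : (⌊t⌋ : ℝ) + 1 ≤ k := by exact_mod_cast hk
      have := min_le_right (t - ⌊t⌋) (σ + 1 - (t - ⌊t⌋))
      have h3 := neg_le_abs (t - k)
      simp only [Z]
      nlinarith
  have hZeq : ∀ t : ℝ, ∃ k : ℤ, Z t = σ * k + (t - k) ∧ 0 ≤ t - k ∨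
      Z t = σ * k - (t - k) ∧ t - k ≤ 0 := by
    intro t
    have h1 := Int.floor_le t
    have h2 := Int.lt_floor_add_one t
    rcases min_choice (t - ⌊t⌋) (σ + 1 - (t - ⌊t⌋)) with h | h
    · exact ⟨⌊t⌋, Or.inl ⟨by simp only [Z, h], by linarith⟩⟩
    · exact ⟨⌊t⌋ + 1, Or.inr ⟨by simp only [Z, h]; push_cast; ring, by push_cast; linarith⟩⟩
  have hZabs : ∀ t : ℝ, ∃ k : ℤ, Z t = σ * k + |t - k| := by
    intro t
    obtain ⟨k, ⟨h, h'⟩ | ⟨h, h'⟩⟩ := hZeq t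
    · exact ⟨k, by rw [h, abs_of_nonneg h']⟩
    · exact ⟨k, by rw [h, abs_of_nonpos h', sub_eq_add_neg]⟩
  have hlip1 : ∀ t t', Z t - Z t' ≤ |t - t'| := by
    intro t t'
    obtain ⟨k, hk⟩ := hZabs t'
    have := hZle t k
    have := abs_sub_le t t' k
    linarith
  have hlip : ∀ t t', |Z t - Z t'| ≤ |t - t'| := fun t t' =>
    abs_le.2 ⟨by have := hlip1 t' t; rw [abs_sub_comm] at this; linarith, hlip1 t t'⟩
  have hcont : Continuous Z :=
    (LipschitzWith.of_dist_le_mul (K := 1) fun t t' => by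
      simpa [Real.dist_eq] using hlip t t').continuous
  have hclose : ∀ t, |Z t - σ * t| ≤ 1 := by
    intro t
    rw [abs_le]
    constructor
    · obtain ⟨k, hk⟩ := hZabs t
      have h1 := le_abs_self (t - k)
      have h2 := abs_nonneg (t - k)
      nlinarith
    · have h1 := hZle t ⌊t⌋
      have h2 := Int.floor_le t
      have h3 := Int.lt_floor_add_one t
      rw [abs_of_nonneg (by linarith)] at h1
      nlinarith
  let sg : Bool → ℝ := fun b => cond b 1 (-1)
  refine ⟨fun t => p * Z (t / p), fun κ => {t | Z (t / p) = σ * κ.1 + sg κ.2 * (t / p - κ.1)},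
    fun t t' => ?_, fun t => ?_, fun κ => ?_, fun t => ?_, fun κ => ⟨sg κ.2, ?_, ?_⟩⟩
  · rw [← mul_sub, abs_mul, abs_of_pos hp, ← le_div_iff₀' hp]
    refine (hlip _ _).trans_eq ?_
    rw [← sub_div, abs_div, abs_of_pos hp]
  · have : p * Z (t / p) - σ * t = p * (Z (t / p) - σ * (t / p)) := by field_simp
    rw [this, abs_mul, abs_of_pos hp]
    exact mul_le_of_le_one_right hp.le (hclose _)
  · exact isClosed_eq (hcont.comp (continuous_id.div_const p)) (by fun_prop)
  · obtain ⟨k, ⟨h, -⟩ | ⟨h, -⟩⟩ := hZeq (t / p)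
    · exact ⟨(k, true), by simp only [mem_ofPred_eq, sg, cond_true, h]; ring⟩
    · exact ⟨(k, false), by simp only [mem_ofPred_eq, sg, cond_false, h]; ring⟩
  · cases κ.2 <;> simp [sg]
  · intro t ht t' ht'
    simp only [mem_ofPred_eq] at ht ht'
    simp only [ht, ht']
    field_simp
    ring

theorem Orthonormal.norm_sq_sum_smul {ι V : Type*} [Fintype ι] [NormedAddCommGroup V]
    [InnerProductSpace ℝ V] {v : ι → V} (hv : Orthonormal ℝ v) (c : ι → ℝ) :
    ‖∑ i, c i • v i‖ ^ 2 = ∑ i, c i ^ 2 := by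
  rw [← real_inner_self_eq_norm_sq, hv.inner_sum]
  simp [sq]

/-- A form of the singular value decomposition. -/
theorem exists_orthonormal_apply_eq_smul {n m : ℕ} (hnm : n ≤ m) (B : Euc n →L[ℝ] Euc m) :
    ∃ (u : OrthonormalBasis (Fin n) ℝ (Euc n)) (v : Fin n → Euc m), Orthonormal ℝ v ∧
      ∀ i, B (u i) = ‖B (u i)‖ • v i := by
  have hsym := (B : Euc n →ₗ[ℝ] Euc m).isSymmetric_adjoint_comp_self
  let u := hsym.eigenvectorBasis finrank_euclideanSpace_fin
  have horth : ∀ i j, i ≠ j → inner ℝ (B (u i)) (B (u j)) = 0 := by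
    intro i j hij
    have h1 : inner ℝ (B (u i)) (B (u j)) =
        inner ℝ (((B : Euc n →ₗ[ℝ] Euc m).adjoint ∘ₗ (B : Euc n →ₗ[ℝ] Euc m)) (u i)) (u j) := by
      rw [LinearMap.comp_apply, LinearMap.adjoint_inner_left]
      rfl
    rw [h1, hsym.apply_eigenvectorBasis, inner_smul_left, u.inner_eq_zero hij, mul_zero]
  let w : Fin m → Euc m := fun j =>
    if h : (j : ℕ) < n then ‖B (u ⟨j, h⟩)‖⁻¹ • B (u ⟨j, h⟩) else 0
  let s : Set (Fin m) := {j | ∃ h : (j : ℕ) < n, B (u ⟨j, h⟩) ≠ 0}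
  have hw : Orthonormal ℝ (s.domRestrict w) := by
    refine ⟨fun ⟨j, h, hj⟩ => ?_, fun ⟨i, h, hi⟩ ⟨j, h', hj⟩ hij => ?_⟩
    · simp only [domRestrict_apply, w, dif_pos h]
      rw [norm_smul, norm_inv, norm_norm, inv_mul_cancel₀ (norm_ne_zero_iff.2 hj)]
    · simp only [domRestrict_apply, w, dif_pos h, dif_pos h']
      rw [inner_smul_left, inner_smul_right, horth, mul_zero, mul_zero]
      intro h2
      exact hij (Subtype.ext (Fin.ext (Fin.mk.inj_iff.1 h2)))
  obtain ⟨b, hb⟩ := hw.exists_orthonormalBasis_extension_of_card_eq (by simp)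
  refine ⟨u, fun i => b (Fin.castLE hnm i),
    b.orthonormal.comp _ (Fin.castLE_injective hnm), fun i => ?_⟩
  by_cases hi : B (u i) = 0
  · rw [hi, norm_zero, zero_smul]
  · dsimp only
    rw [hb (Fin.castLE hnm i) ⟨i.2, hi⟩]
    have : w (Fin.castLE hnm i) = ‖B (u i)‖⁻¹ • B (u i) := dif_pos i.2
    rw [this, smul_inv_smul₀ (norm_ne_zero_iff.2 hi)]

/-- A linear contraction `ℝⁿ → ℝᵐ` with `n ≤ m` can be uniformly approximated by foldings:
1-Lipschitz maps which are isometric on each of countably many closed cells. -/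
theorem exists_folding {n m : ℕ} (hnm : n ≤ m) {B : Euc n →L[ℝ] Euc m} (hB : ‖B‖ ≤ 1)
    {δ : ℝ} (hδ : 0 < δ) :
    ∃ (ζ : Euc n → Euc m) (S : (Fin n → ℤ × Bool) → Set (Euc n)),
      (∀ z z', ‖ζ z - ζ z'‖ ≤ ‖z - z'‖) ∧ (∀ z, ‖ζ z - B z‖ ≤ δ) ∧ (∀ κ, IsClosed (S κ)) ∧
      (∀ z, ∃ κ, z ∈ S κ) ∧ ∀ κ, ∃ T : Euc m →L[ℝ] Euc n, ‖T‖ ≤ 1 ∧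
        ∀ z ∈ S κ, ∀ z' ∈ S κ, T (ζ z - ζ z') = z - z' := by
  obtain ⟨u, v, hv, hBu⟩ := exists_orthonormal_apply_eq_smul hnm B
  have hσ1 : ∀ i, ‖B (u i)‖ ≤ 1 := fun i => by simpa using B.le_of_opNorm_le hB (u i)
  have hp : 0 < δ / (n + 1) := by positivity
  choose ψ C hψ hψσ hCc hCcov hCs using fun i => exists_zigzag (norm_nonneg (B (u i))) (hσ1 i) hp
  choose s hs hsψ using hCs
  let ζ : Euc n → Euc m := fun z => ∑ i, ψ i (inner ℝ (u i) z) • v i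
  have hsub : ∀ z z', ζ z - ζ z' =
      ∑ i, (ψ i (inner ℝ (u i) z) - ψ i (inner ℝ (u i) z')) • v i := by
    intro z z'
    simp only [ζ, sub_smul, Finset.sum_sub_distrib]
  refine ⟨ζ, fun κ => ⋂ i, (fun z => inner ℝ (u i) z) ⁻¹' C i (κ i), fun z z' => ?_, fun z => ?_,
    fun κ => isClosed_iInter fun i => (hCc i (κ i)).preimage (by fun_prop), fun z => ?_,
    fun κ => ?_⟩
  · refine le_of_sq_le_sq ?_ (norm_nonneg _)
    rw [hsub, hv.norm_sq_sum_smul, ← u.sum_sq_inner_right (z - z')]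
    refine Finset.sum_le_sum fun i _ => sq_le_sq.2 ?_
    rw [inner_sub_right]
    exact hψ i _ _
  · have h1 : B z = ∑ i, (‖B (u i)‖ * inner ℝ (u i) z) • v i := by
      conv_lhs => rw [← u.sum_repr' z, map_sum]
      refine Finset.sum_congr rfl fun i _ => ?_
      rw [map_smul, hBu i, smul_smul, mul_comm, norm_smul, norm_norm, hv.1 i, mul_one]
    have h2 : ζ z - B z = ∑ i, (ψ i (inner ℝ (u i) z) - ‖B (u i)‖ * inner ℝ (u i) z) • v i := by
      rw [h1]
      simp only [ζ, sub_smul, Finset.sum_sub_distrib]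
    rw [h2]
    calc _ ≤ ∑ _i : Fin n, δ / (n + 1) := by
          refine norm_sum_le_of_le _ fun i _ => ?_
          rw [norm_smul, hv.1 i, mul_one]
          exact hψσ i _
      _ = n * (δ / (n + 1)) := by simp
      _ ≤ δ := by
        rw [mul_div_assoc', div_le_iff₀ (by positivity)]
        nlinarith
  · choose κ hκ using fun i => hCcov i (inner ℝ (u i) z)
    exact ⟨κ, mem_iInter.2 hκ⟩
  · let T : Euc m →L[ℝ] Euc n := ∑ i, s i (κ i) • (innerSL ℝ (v i)).smulRight (u i)
    have hT : ∀ w, T w = ∑ i, (s i (κ i) * inner ℝ (v i) w) • u i := by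
      intro w
      simp [T, smul_smul]
    refine ⟨T, T.opNorm_le_bound zero_le_one fun w => ?_, fun z hz z' hz' => ?_⟩
    · rw [one_mul]
      refine le_of_sq_le_sq ?_ (norm_nonneg _)
      rw [hT, u.orthonormal.norm_sq_sum_smul]
      refine le_trans (le_of_eq ?_) (hv.sum_inner_products_le w (s := Finset.univ))
      refine Finset.sum_congr rfl fun i _ => ?_
      rw [mul_pow, hs, one_mul, Real.norm_eq_abs, sq_abs]
    · rw [hT, hsub, ← u.sum_repr' (z - z')]
      refine Finset.sum_congr rfl fun i _ => ?_
      rw [inner_sum]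
      simp only [inner_smul_right]
      rw [Finset.sum_eq_single i]
      · rw [real_inner_self_eq_norm_sq, hv.1 i,
          hsψ i (κ i) _ (mem_iInter.1 hz i) _ (mem_iInter.1 hz' i), inner_sub_right]
        congr 1
        linear_combination (inner ℝ (u i) z - inner ℝ (u i) z') * hs i (κ i)
      · intro j _ hj
        rw [hv.2 hj.symm, mul_zero]
      · simp

end Folding

section Decomposition

theorem exists_contraction_isometric_on_range {n k : ℕ} {A : Euc n →L[ℝ] Euc k}
    (hA : Function.Injective A) :
    ∃ P : Euc k →L[ℝ] Euc n, ‖P‖ ≤ 1 ∧ ∀ z, ‖P (A z)‖ = ‖A z‖ := by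
  obtain ⟨V, hVA⟩ : ∃ V : Submodule ℝ (Euc k), V = LinearMap.range (A : Euc n →ₗ[ℝ] Euc k) :=
    ⟨_, rfl⟩
  have hV : Module.finrank ℝ V = n := by
    rw [hVA, LinearMap.finrank_range_of_inj hA, finrank_euclideanSpace_fin]
  let b := (stdOrthonormalBasis ℝ V).reindex (finCongr hV)
  refine ⟨(b.repr.toContinuousLinearEquiv : V →L[ℝ] Euc n).comp V.orthogonalProjectionOnto,
    ContinuousLinearMap.opNorm_le_bound _ zero_le_one fun w => ?_, fun z => ?_⟩
  · rw [one_mul, ContinuousLinearMap.comp_apply]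
    exact le_trans (le_of_eq (b.repr.norm_map _))
      (V.norm_orthogonalProjectionOnto_apply_le w)
  · rw [ContinuousLinearMap.comp_apply]
    refine (b.repr.norm_map _).trans ?_
    have hz : A z ∈ V := by rw [hVA]; exact ⟨z, rfl⟩
    have h := V.orthogonalProjectionOnto_mem_subspace_eq_self ⟨A z, hz⟩
    rw [h, Submodule.coe_norm]

theorem exists_factor_of_norm_le {n k m : ℕ} {A : Euc n →L[ℝ] Euc k} (hA : Function.Injective A)
    {P : Euc k →L[ℝ] Euc n} (hP : ∀ z, ‖P (A z)‖ = ‖A z‖) {B : Euc n →L[ℝ] Euc m} {l : NNReal}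
    (hB : ∀ z, ‖B z‖ ≤ l * ‖A z‖) :
    ∃ B' : Euc n →L[ℝ] Euc m, ‖B'‖ ≤ l ∧ ∀ z, B' (P (A z)) = B z := by
  have hR : Function.Injective ((P.comp A : Euc n →L[ℝ] Euc n) : Euc n →ₗ[ℝ] Euc n) := by
    refine (injective_iff_map_eq_zero _).2 fun z hz => ?_
    have h1 : P (A z) = 0 := hz
    have h2 := hP z
    rw [h1, norm_zero, eq_comm, norm_eq_zero] at h2
    exact (map_eq_zero_iff A hA).1 h2
  let R := LinearEquiv.ofInjectiveEndo _ hR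
  have hRz : ∀ z, R z = P (A z) := fun z => rfl
  let B' : Euc n →L[ℝ] Euc m := LinearMap.toContinuousLinearMap
    ((B : Euc n →ₗ[ℝ] Euc m) ∘ₗ (R.symm : Euc n →ₗ[ℝ] Euc n))
  have hB' : ∀ z, B' (R z) = B z := fun z => by
    simp [B']
  refine ⟨B', B'.opNorm_le_bound l.2 fun w => ?_, fun z => by rw [← hRz, hB']⟩
  obtain ⟨z, rfl⟩ := R.surjective w
  rw [hB', hRz, hP]
  exact hB z

theorem norm_fderiv_comp_le {n k m : ℕ} {φ : Euc n → Euc k} {f : Euc k → Euc m} {l : NNReal}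
    (hf : LipschitzWith l f) {x : Euc n} {A : Euc n →L[ℝ] Euc k} {B : Euc n →L[ℝ] Euc m}
    (hA : HasFDerivAt φ A x) (hB : HasFDerivAt (fun x => f (φ x)) B x) (z : Euc n) :
    ‖B z‖ ≤ l * ‖A z‖ := by
  have h1 := (hA.hasLineDerivAt z).tendsto_slope_zero.norm
  have h2 := (hB.hasLineDerivAt z).tendsto_slope_zero.norm
  refine le_of_tendsto_of_tendsto' h2 (h1.const_mul (l : ℝ)) fun t => ?_
  rw [norm_smul, norm_smul, mul_left_comm]
  gcongr
  simpa [dist_eq_norm] using hf.dist_le_mul _ _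

theorem forall_mem_closure_le {X : Type*} [TopologicalSpace X] {F G : X × X → ℝ}
    (hF : Continuous F) (hG : Continuous G) {S : Set X}
    (h : ∀ p ∈ S, ∀ q ∈ S, F (p, q) ≤ G (p, q)) {p q : X} (hp : p ∈ closure S)
    (hq : q ∈ closure S) : F (p, q) ≤ G (p, q) := by
  have h1 : (p, q) ∈ closure (S ×ˢ S) := by
    rw [closure_prod_eq]; exact ⟨hp, hq⟩
  exact closure_minimal (fun w hw => h w.1 hw.1 w.2 hw.2) (isClosed_le hF hG) h1

theorem forall_mem_closure_approx {n k m : ℕ} {f : Euc k → Euc m} (hf : Continuous f)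
    (P : Euc k →L[ℝ] Euc n) (B : Euc n →L[ℝ] Euc m) {η : ℝ} {S : Set (Euc k)}
    (h : ∀ p ∈ S, ∀ q ∈ S, (1 - η) * ‖p - q‖ ≤ ‖P (p - q)‖ ∧
      ‖f p - f q - B (P (p - q))‖ ≤ η * ‖p - q‖) :
    ∀ p ∈ closure S, ∀ q ∈ closure S, (1 - η) * ‖p - q‖ ≤ ‖P (p - q)‖ ∧
      ‖f p - f q - B (P (p - q))‖ ≤ η * ‖p - q‖ := by
  intro p hp q hq
  have hc : Continuous fun w : Euc k × Euc k => ‖w.1 - w.2‖ :=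
    (continuous_fst.sub continuous_snd).norm
  have hP : Continuous fun w : Euc k × Euc k => P (w.1 - w.2) :=
    P.continuous.comp (continuous_fst.sub continuous_snd)
  have hf' : Continuous fun w : Euc k × Euc k => f w.1 - f w.2 - B (P (w.1 - w.2)) :=
    ((hf.comp continuous_fst).sub (hf.comp continuous_snd)).sub (B.continuous.comp hP)
  have h1 := forall_mem_closure_le ((continuous_const (y := 1 - η)).mul hc) hP.norm
    (fun p hp q hq => (h p hp q hq).1) hp hq
  have h2 := forall_mem_closure_le hf'.norm ((continuous_const (y := η)).mul hc)
    (fun p hp q hq => (h p hp q hq).2) hp hq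
  exact ⟨h1, h2⟩

/-- The image of the set where the derivative of a Lipschitz map `φ` is injective is covered by
countably many closed sets on each of which `f` is close to a linear function of an almost isometric
linear chart. -/
theorem exists_closed_cover_image {n m k : ℕ} {φ : Euc n → Euc k} {f : Euc k → Euc m} {l : NNReal}
    (hf : LipschitzWith l f) {η : ℝ} (hη : 0 < η) :
    ∃ W : ℕ → Set (Euc k), (∀ j, IsClosed (W j)) ∧
      φ '' {x | DifferentiableAt ℝ φ x ∧ DifferentiableAt ℝ (fun x => f (φ x)) x ∧
        Function.Injective (fderiv ℝ φ x)} ⊆ ⋃ j, W j ∧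
      ∀ j, ∃ (P : Euc k →L[ℝ] Euc n) (B : Euc n →L[ℝ] Euc m), ‖P‖ ≤ 1 ∧ ‖B‖ ≤ l ∧
        ∀ p ∈ W j, ∀ q ∈ W j, (1 - η) * ‖p - q‖ ≤ ‖P (p - q)‖ ∧
          ‖f p - f q - B (P (p - q))‖ ≤ η * ‖p - q‖ := by
  set s := {x | DifferentiableAt ℝ φ x ∧ DifferentiableAt ℝ (fun x => f (φ x)) x ∧
        Function.Injective (fderiv ℝ φ x)} with hs
  rcases s.eq_empty_or_nonempty with h0 | hne
  · exact ⟨fun _ => ∅, fun _ => isClosed_empty, by simp [h0], fun _ => ⟨0, 0, by simp⟩⟩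
  obtain ⟨τ, hτ0, hτ1, hτη, hτl⟩ : ∃ τ : ℝ, 0 < τ ∧ τ ≤ 1 / 2 ∧ 4 * τ ≤ η ∧
      2 * τ * (1 + l) ≤ η := by
    refine ⟨min (1 / 2) (η / (4 * (1 + l))), by positivity, min_le_left _ _, ?_, ?_⟩
    · have h1 := min_le_right (1 / 2) (η / (4 * (1 + l)))
      rw [le_div_iff₀ (by positivity)] at h1
      have : (0:ℝ) < min (1 / 2) (η / (4 * (1 + l))) := by positivity
      nlinarith [l.2]
    · have h1 := min_le_right (1 / 2) (η / (4 * (1 + l)))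
      rw [le_div_iff₀ (by positivity)] at h1
      have : (0:ℝ) < min (1 / 2) (η / (4 * (1 + l))) := by positivity
      nlinarith [l.2]
  let Φ : Euc n → Euc k × Euc m := fun x => (φ x, f (φ x))
  have hr : ∀ C : Euc n →L[ℝ] Euc k × Euc m, ∃ r : NNReal, r ≠ 0 ∧
      (Function.Injective (fun z => (C z).1) → ∀ z, r * ‖z‖ ≤ τ * ‖(C z).1‖) := by
    intro C
    by_cases hC : Function.Injective (fun z => (C z).1)
    · obtain ⟨c, hc, hcC⟩ := (((ContinuousLinearMap.fst ℝ (Euc k) (Euc m)).comp C :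
        Euc n →L[ℝ] Euc k) : Euc n →ₗ[ℝ] Euc k).exists_antilipschitzWith
          (LinearMap.ker_eq_bot.2 hC)
      refine ⟨τ.toNNReal * c⁻¹, by positivity, fun _ z => ?_⟩
      have h1 := hcC.le_mul_dist z 0
      simp only [dist_zero_right, map_zero] at h1
      have h2 : ‖z‖ ≤ c * ‖(C z).1‖ := h1
      rw [NNReal.coe_mul, Real.coe_toNNReal _ hτ0.le, NNReal.coe_inv, mul_assoc]
      gcongr
      rwa [inv_mul_le_iff₀ (by exact_mod_cast hc)]
    · exact ⟨1, one_ne_zero, fun h => absurd h hC⟩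
  choose r hr0 hr using hr
  obtain ⟨t, A, ht, hst, hA, hAs⟩ :=
    exists_closed_cover_approximatesLinearOn_of_hasFDerivWithinAt Φ s
      (fun x => (fderiv ℝ φ x).prod (fderiv ℝ (fun x => f (φ x)) x))
      (fun x hx => (hx.1.hasFDerivAt.prodMk hx.2.1.hasFDerivAt).hasFDerivWithinAt) r hr0
  refine ⟨fun j => closure (φ '' (s ∩ t j)), fun _ => isClosed_closure, ?_, fun j => ?_⟩
  · rintro _ ⟨x, hx, rfl⟩
    obtain ⟨j, hj⟩ := mem_iUnion.1 (hst hx)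
    exact mem_iUnion.2 ⟨j, subset_closure ⟨x, ⟨hx, hj⟩, rfl⟩⟩
  obtain ⟨y, hy, hAy⟩ := hAs hne j
  have hAz : ∀ z, A j z = (fderiv ℝ φ y z, fderiv ℝ (fun x => f (φ x)) y z) := fun z => by
    rw [hAy]; rfl
  set A₁ := fderiv ℝ φ y
  set A₂ := fderiv ℝ (fun x => f (φ x)) y
  have hrj : ∀ z, r (A j) * ‖z‖ ≤ τ * ‖A₁ z‖ := by
    have := hr (A j)
    simp only [hAz] at this
    exact this hy.2.2
  obtain ⟨P, hP1, hP⟩ := exists_contraction_isometric_on_range hy.2.2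
  obtain ⟨B, hB1, hB⟩ := exists_factor_of_norm_le hy.2.2 hP
    (norm_fderiv_comp_le hf hy.1.hasFDerivAt hy.2.1.hasFDerivAt)
  refine ⟨P, B, hP1, hB1, ?_⟩
  have key : ∀ p ∈ φ '' (s ∩ t j), ∀ q ∈ φ '' (s ∩ t j), (1 - η) * ‖p - q‖ ≤ ‖P (p - q)‖ ∧
          ‖f p - f q - B (P (p - q))‖ ≤ η * ‖p - q‖ := by
    rintro _ ⟨x, hx, rfl⟩ _ ⟨x', hx', rfl⟩
    have h1 := hA j x hx x' hx'
    rw [hAz] at h1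
    set z := x - x'
    have h2 : ‖φ x - φ x' - A₁ z‖ ≤ r (A j) * ‖z‖ := (norm_fst_le _).trans h1
    have h3 : ‖f (φ x) - f (φ x') - A₂ z‖ ≤ r (A j) * ‖z‖ := (norm_snd_le _).trans h1
    have h4 := hrj z
    set p := φ x
    set q := φ x'
    have h5 : ‖A₁ z‖ ≤ ‖p - q‖ + ‖p - q - A₁ z‖ := by
      exact norm_le_norm_add_norm_sub _ _
    have h5' : ‖p - q‖ ≤ ‖p - q - A₁ z‖ + ‖A₁ z‖ := norm_le_norm_sub_add _ _
    have h6 : r (A j) * ‖z‖ ≤ 2 * τ * ‖p - q‖ := by nlinarith [norm_nonneg (p - q)]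
    have h7 : ‖P (p - q - A₁ z)‖ ≤ ‖p - q - A₁ z‖ := by
      simpa using P.le_of_opNorm_le hP1 (p - q - A₁ z)
    constructor
    · have h8 : ‖P (A₁ z)‖ ≤ ‖P (p - q)‖ + ‖P (p - q - A₁ z)‖ := by
        rw [map_sub P (p - q)]; exact norm_le_norm_add_norm_sub _ _
      rw [hP] at h8
      nlinarith [norm_nonneg (p - q)]
    · have h9 : f p - f q - B (P (p - q)) = (f p - f q - A₂ z) - B (P (p - q - A₁ z)) := by
        rw [map_sub P (p - q), map_sub B, hB]; abel
      rw [h9]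
      calc _ ≤ ‖f p - f q - A₂ z‖ + ‖B (P (p - q - A₁ z))‖ := norm_sub_le _ _
        _ ≤ r (A j) * ‖z‖ + l * (r (A j) * ‖z‖) := by
          gcongr
          refine (B.le_of_opNorm_le hB1 _).trans ?_
          gcongr
          exact h7.trans h2
        _ = (1 + l) * (r (A j) * ‖z‖) := by ring
        _ ≤ (1 + l) * (2 * τ * ‖p - q‖) := by gcongr
        _ = 2 * τ * (1 + l) * ‖p - q‖ := by ring
        _ ≤ η * ‖p - q‖ := by gcongr
  exact fun p hp q hq => forall_mem_closure_approx hf.continuous P B key p hp q hq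

theorem IsRectifiable.exists_lipschitz_cover {n k : ℕ} {E : Set (Euc k)} (hE : IsRectifiable n E) :
    ∃ (φ : ℕ → Euc n → Euc k) (K : ℕ → NNReal), (∀ i, LipschitzWith (K i) (φ i)) ∧
      μH[n] (E \ ⋃ i, range (φ i)) = 0 := by
  obtain ⟨-, F, f, K, hf, hnull⟩ := hE
  choose φ hφ hφf using fun i => (hf i).extend_finite_dimension
  refine ⟨φ, _, hφ, measure_mono_null (sdiff_subset_sdiff_right (iUnion_mono fun i => ?_)) hnull⟩
  rw [(hφf i).image_eq]
  exact image_subset_range _ _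

theorem exists_closed_cover_ae {n m k : ℕ} {E : Set (Euc k)} (hE : IsRectifiable n E)
    {f : Euc k → Euc m} {l : NNReal} (hf : LipschitzWith l f) {η : ℝ} (hη : 0 < η) :
    ∃ W : ℕ × ℕ → Set (Euc k), (∀ j, IsClosed (W j)) ∧ μH[n] (E \ ⋃ j, W j) = 0 ∧
      ∀ j, ∃ (P : Euc k →L[ℝ] Euc n) (B : Euc n →L[ℝ] Euc m), ‖P‖ ≤ 1 ∧ ‖B‖ ≤ l ∧
        ∀ p ∈ W j, ∀ q ∈ W j, (1 - η) * ‖p - q‖ ≤ ‖P (p - q)‖ ∧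
          ‖f p - f q - B (P (p - q))‖ ≤ η * ‖p - q‖ := by
  obtain ⟨φ, K, hφ, hnull⟩ := hE.exists_lipschitz_cover
  choose W hWc hWcov hW using fun i => exists_closed_cover_image (φ := φ i) hf hη
  refine ⟨fun j => W j.1 j.2, fun j => hWc j.1 j.2, ?_, fun j => hW j.1 j.2⟩
  have h1 : ∀ i, μH[n] (φ i '' {x | ¬ DifferentiableAt ℝ (φ i) x}) = 0 := fun i =>
    (hφ i).lipschitzOnWith.hausdorffMeasure_image_eq_zero
      ((hφ i).ae_differentiableAt (μ := μH[n]))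
  have h2 : ∀ i, μH[n] (φ i '' {x | ¬ DifferentiableAt ℝ (fun x => f (φ i x)) x}) = 0 := fun i =>
    (hφ i).lipschitzOnWith.hausdorffMeasure_image_eq_zero
      ((hf.comp (hφ i)).ae_differentiableAt (μ := μH[n]))
  have h3 := fun i => (hφ i).hausdorffMeasure_image_not_injective_fderiv
  refine measure_mono_null ?_ (measure_union_null hnull (measure_iUnion_null fun i =>
    measure_union_null (h1 i) (measure_union_null (h2 i) (h3 i))))
  rintro p ⟨hpE, hpW⟩
  by_cases hp : p ∈ ⋃ i, range (φ i)
  · right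
    obtain ⟨i, x, rfl⟩ := mem_iUnion.1 hp
    refine mem_iUnion.2 ⟨i, ?_⟩
    by_cases hx1 : DifferentiableAt ℝ (φ i) x
    swap
    · exact Or.inl ⟨x, hx1, rfl⟩
    by_cases hx2 : DifferentiableAt ℝ (fun x => f (φ i x)) x
    swap
    · exact Or.inr (Or.inl ⟨x, hx2, rfl⟩)
    by_cases hx3 : Function.Injective (fderiv ℝ (φ i) x)
    swap
    · exact Or.inr (Or.inr ⟨x, ⟨hx1, hx3⟩, rfl⟩)
    obtain ⟨j, hj⟩ := mem_iUnion.1 (hWcov i ⟨x, ⟨hx1, hx2, hx3⟩, rfl⟩)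
    exact absurd (mem_iUnion.2 ⟨(i, j), hj⟩) hpW
  · exact Or.inl ⟨hpE, hp⟩

end Decomposition

section Folded

theorem exists_norm_eq_one_apply_eq_zero {n m : ℕ} (hnm : n < m) (T : Euc m →L[ℝ] Euc n) :
    ∃ v : Euc m, ‖v‖ = 1 ∧ T v = 0 := by
  have h := LinearMap.ker_ne_bot_of_finrank_lt (f := (T : Euc m →ₗ[ℝ] Euc n)) (by simpa using hnm)
  obtain ⟨v, hv, hv0⟩ := (Submodule.ne_bot_iff _).1 h
  refine ⟨‖v‖⁻¹ • v, ?_, ?_⟩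
  · rw [norm_smul, norm_inv, norm_norm, inv_mul_cancel₀ (norm_ne_zero_iff.2 hv0)]
  · rw [map_smul, show T v = 0 from hv, smul_zero]

/-- On a set where `f` is almost linear in an almost isometric chart, `f` can be approximated by
strictly contracting maps which are nearly isometric on countably many closed cells. -/
theorem exists_folded_perturbation {n m k : ℕ} (hnm : n < m) {W : Set (Euc k)}
    {f : Euc k → Euc m} {P : Euc k →L[ℝ] Euc n} {B : Euc n →L[ℝ] Euc m} {s : ℝ} (hs0 : 0 < s)
    (hs1 : s < 1) (hP : ‖P‖ ≤ 1) (hB : ‖B‖ ≤ s)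
    (hW : ∀ p ∈ W, ∀ q ∈ W, (1 - (1 - s) / 2) * ‖p - q‖ ≤ ‖P (p - q)‖ ∧
      ‖f p - f q - B (P (p - q))‖ ≤ (1 - s) / 2 * ‖p - q‖) {δ : ℝ} (hδ : 0 < δ) :
    ∃ (h : Euc k → Euc m) (S : (Fin n → ℤ × Bool) → Set (Euc k)), (∀ p, ‖h p - f p‖ ≤ δ) ∧
      (∀ p ∈ W, ∀ q ∈ W, ‖h p - h q‖ ≤ (1 + s) / 2 * ‖p - q‖) ∧ (∀ κ, IsClosed (S κ)) ∧
      (∀ p, ∃ κ, p ∈ S κ) ∧ ∀ κ, ∃ (T : Euc m →L[ℝ] Euc n), ‖T‖ ≤ 1 ∧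
        ∀ p ∈ W ∩ S κ, ∀ q ∈ W ∩ S κ, (2 * s - 1) * ‖p - q‖ ≤ ‖T (h p - h q)‖ := by
  have hB' : ‖s⁻¹ • B‖ ≤ 1 := by
    rw [norm_smul, norm_inv, Real.norm_of_nonneg hs0.le, inv_mul_le_iff₀ hs0, mul_one]
    exact hB
  obtain ⟨ζ, S, hζ, hζB, hSc, hScov, hST⟩ := exists_folding hnm.le hB' hδ
  have hdiff : ∀ p q, f p + (s • ζ (P p) - B (P p)) - (f q + (s • ζ (P q) - B (P q))) =
      (f p - f q - B (P (p - q))) + s • (ζ (P p) - ζ (P q)) := by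
    intro p q
    rw [map_sub, map_sub]
    module
  have hPn : ∀ p q, ‖P p - P q‖ ≤ ‖p - q‖ := fun p q => by
    rw [← map_sub]; simpa using P.le_of_opNorm_le hP (p - q)
  refine ⟨fun p => f p + (s • ζ (P p) - B (P p)), fun κ => P ⁻¹' S κ, fun p => ?_,
    fun p hp q hq => ?_, fun κ => (hSc κ).preimage P.continuous, fun p => hScov (P p),
    fun κ => ?_⟩
  · have : f p + (s • ζ (P p) - B (P p)) - f p = s • (ζ (P p) - (s⁻¹ • B) (P p)) := by
      rw [smul_sub, smul_apply, smul_inv_smul₀ hs0.ne']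
      abel
    rw [this, norm_smul, Real.norm_of_nonneg hs0.le]
    nlinarith [hζB (P p), norm_nonneg (ζ (P p) - (s⁻¹ • B) (P p))]
  · rw [hdiff]
    refine (norm_add_le _ _).trans ?_
    rw [norm_smul, Real.norm_of_nonneg hs0.le]
    have h1 := (hW p hp q hq).2
    have h2 := (hζ (P p) (P q)).trans (hPn p q)
    nlinarith
  · obtain ⟨T, hT, hTS⟩ := hST κ
    refine ⟨T, hT, fun p hp q hq => ?_⟩
    have h1 := (hW p hp.1 q hq.1).1
    have h2 : ‖T (f p - f q - B (P (p - q)))‖ ≤ (1 - s) / 2 * ‖p - q‖ :=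
      (T.le_of_opNorm_le hT _).trans ((one_mul _).trans_le (hW p hp.1 q hq.1).2)
    simp only [hdiff]
    rw [map_add, map_smul, hTS _ hp.2 _ hq.2, ← map_sub]
    have h3 := norm_sub_le (T (f p - f q - B (P (p - q))) + s • P (p - q))
      (T (f p - f q - B (P (p - q))))
    rw [add_sub_cancel_left, norm_smul, Real.norm_of_nonneg hs0.le] at h3
    have h4 : 0 ≤ (1 - s) ^ 2 / 2 * ‖p - q‖ := by positivity
    have h5 := mul_le_mul_of_nonneg_left h1 hs0.le
    linarith

end Folded

section CompactPieces

/-- A set of finite measure which is covered up to a null set by countably many measurable sets can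
be exhausted by finitely many disjoint compact sets subordinate to the cover. -/
theorem exists_disjoint_compact_pieces {k : ℕ} {μ : Measure (Euc k)} {E : Set (Euc k)}
    (hE : MeasurableSet E) (hμE : μ E ≠ ∞) {W : ℕ → Set (Euc k)} (hW : ∀ j, MeasurableSet (W j))
    (hEW : μ (E \ ⋃ j, W j) = 0) {ε : ℝ≥0∞} (hε : ε ≠ 0) :
    ∃ (N : ℕ) (K : ℕ → Set (Euc k)), (∀ i, IsCompact (K i)) ∧ (∀ i, K i ⊆ E ∩ W i) ∧
      Pairwise (Function.onFun Disjoint K) ∧ μ (E \ ⋃ i < N, K i) ≤ ε := by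
  have : IsFiniteMeasure (μ.restrict E) := isFiniteMeasure_restrict.2 hμE
  obtain ⟨e, he, hesum⟩ := ENNReal.exists_pos_sum_of_countable' hε ℕ
  have hD : ∀ i, MeasurableSet (E ∩ disjointed W i) := fun i =>
    hE.inter (MeasurableSet.disjointed hW i)
  have hK : ∀ i, ∃ K ⊆ E ∩ disjointed W i, IsCompact K ∧
      μ ((E ∩ disjointed W i) \ K) < e i := by
    intro i
    obtain ⟨K, hKs, hKc, hlt⟩ := (hD i).exists_isCompact_sdiff_lt
      (measure_ne_top (μ.restrict E) _) (he i).ne'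
    refine ⟨K, hKs, hKc, ?_⟩
    rwa [Measure.restrict_apply ((hD i).diff hKc.measurableSet), inter_eq_left.2
      (sdiff_subset.trans inter_subset_left)] at hlt
  choose K hKs hKc hKμ using hK
  have hlt : μ (E \ ⋃ i, K i) < ε := by
    have hsub : E \ ⋃ i, K i ⊆ (E \ ⋃ j, W j) ∪ ⋃ i, (E ∩ disjointed W i) \ K i := by
      rintro p ⟨hp, hpK⟩
      by_cases hpW : p ∈ ⋃ j, W j
      · rw [← iUnion_disjointed] at hpW
        obtain ⟨i, hi⟩ := mem_iUnion.1 hpW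
        exact Or.inr (mem_iUnion.2 ⟨i, ⟨hp, hi⟩, fun h => hpK (mem_iUnion.2 ⟨i, h⟩)⟩)
      · exact Or.inl ⟨hp, hpW⟩
    calc μ (E \ ⋃ i, K i) ≤ 0 + ∑' i, μ ((E ∩ disjointed W i) \ K i) := by
          refine (measure_mono hsub).trans ((measure_union_le _ _).trans ?_)
          rw [hEW]
          gcongr
          exact measure_iUnion_le _
      _ ≤ ∑' i, e i := by
          rw [zero_add]
          exact ENNReal.tsum_le_tsum fun i => (hKμ i).le
      _ < ε := hesum
  have hsdiff : E \ ⋃ i, K i = ⋂ N : ℕ, E \ ⋃ i < N, K i := by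
    ext p
    simp only [Set.mem_sdiff, mem_iUnion, mem_iInter, not_exists]
    exact ⟨fun h N => ⟨h.1, fun i _ => h.2 i⟩,
      fun h => ⟨(h 0).1, fun i => (h (i + 1)).2 i (Nat.lt_succ_self i)⟩⟩
  have hlim : Tendsto (fun N : ℕ => μ (E \ ⋃ i < N, K i)) atTop (𝓝 (μ (E \ ⋃ i, K i))) := by
    rw [hsdiff]
    refine tendsto_measure_iInter_atTop (fun N => ?_) (fun a b hab => ?_) ⟨0, ?_⟩
    · exact (hE.diff (MeasurableSet.iUnion fun i => MeasurableSet.iUnion fun _ =>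
        (hKc i).measurableSet)).nullMeasurableSet
    · refine sdiff_subset_sdiff_right ?_
      exact biUnion_subset_biUnion_left fun i (hi : i < a) => lt_of_lt_of_le hi hab
    · exact measure_ne_top_of_subset sdiff_subset hμE
  obtain ⟨N, hN⟩ := (hlim.eventually (gt_mem_nhds hlt)).exists
  refine ⟨N, K, hKc, fun i => (hKs i).trans (inter_subset_inter_right _ (disjointed_le W i)),
    fun i j hij => ?_, hN.le⟩
  exact (disjoint_disjointed W hij).mono ((hKs i).trans inter_subset_right)
    ((hKs j).trans inter_subset_right)

theorem exists_gap_of_disjoint_compact {X : Type*} [MetricSpace X] {K : ℕ → Set X} {N : ℕ}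
    (hK : ∀ i < N, IsCompact (K i)) (hd : ∀ i < N, ∀ j < N, i ≠ j → Disjoint (K i) (K j)) :
    ∃ d > 0, ∀ i < N, ∀ j < N, i ≠ j → ∀ p ∈ K i, ∀ q ∈ K j, d ≤ dist p q := by
  have h1 : ∀ i ∈ Finset.range N, ∀ j ∈ Finset.range N, ∀ᶠ d in 𝓝[>] (0 : ℝ),
      i ≠ j → ∀ p ∈ K i, ∀ q ∈ K j, d ≤ dist p q := by
    intro i hi j hj
    by_cases hij : i = j
    · exact Eventually.of_forall fun _ h => absurd hij h
    rw [Finset.mem_range] at hi hj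
    obtain ⟨r, hr, h⟩ := Metric.exists_pos_forall_lt_edist (hK i hi) (hK j hj).isClosed
      (hd i hi j hj hij)
    filter_upwards [Ioo_mem_nhdsGT (NNReal.coe_pos.2 hr)] with d hd' _ p hp q hq
    have h2 := h p hp q hq
    rw [edist_nndist, ENNReal.coe_lt_coe, ← NNReal.coe_lt_coe, coe_nndist] at h2
    exact (hd'.2.trans h2).le
  have h2 : ∀ᶠ d in 𝓝[>] (0 : ℝ), ∀ i ∈ Finset.range N, ∀ j ∈ Finset.range N,
      i ≠ j → ∀ p ∈ K i, ∀ q ∈ K j, d ≤ dist p q :=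
    (eventually_all_finset _).2 fun i hi => (eventually_all_finset _).2 fun j hj => h1 i hi j hj
  obtain ⟨d, hd, hd0⟩ := (h2.and self_mem_nhdsWithin).exists
  exact ⟨d, hd0, fun i hi j hj => hd i (Finset.mem_range.2 hi) j (Finset.mem_range.2 hj)⟩

end CompactPieces

section Contracting

/-- A contracting map on a rectifiable set of finite measure can be approximated by contracting maps
which are nearly isometric on finitely many disjoint compact pieces of almost full measure. -/
theorem exists_contracting_approximation {n m k : ℕ} (hnm : n < m) {E : Set (Euc k)}
    (hE : MeasurableSet E) (hμE : μH[n] E ≠ ∞) (hR : IsRectifiable n E) {f : Euc k → Euc m}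
    {l : NNReal} (hf : LipschitzWith l f) {s : ℝ} (hls : l ≤ s) (hs0 : 0 < s) (hs1 : s < 1)
    {ε : ℝ≥0∞} (hε : ε ≠ 0) {δ : ℝ} (hδ : 0 < δ) :
    ∃ (N : ℕ) (K : ℕ → Set (Euc k)) (h : Euc k → Euc m), (∀ i, IsCompact (K i)) ∧
      (∀ i, K i ⊆ E) ∧ Pairwise (Function.onFun Disjoint K) ∧ μH[n] (E \ ⋃ i < N, K i) ≤ ε ∧
      (∀ p, ‖h p - f p‖ ≤ δ) ∧ (∀ p ∈ ⋃ i < N, K i, ∀ q ∈ ⋃ i < N, K i,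
        ‖h p - h q‖ ≤ (1 + s) / 2 * ‖p - q‖) ∧
      ∀ i, ∃ T : Euc m →L[ℝ] Euc n, ‖T‖ ≤ 1 ∧
        ∀ p ∈ K i, ∀ q ∈ K i, (2 * s - 1) * ‖p - q‖ ≤ ‖T (h p - h q)‖ := by
  obtain ⟨V, hVc, hEV, hV⟩ := exists_closed_cover_ae hR hf (η := (1 - s) / 2) (by linarith)
  obtain ⟨e, he⟩ := exists_surjective_nat (ℕ × ℕ)
  have hε2 : ε / 2 ≠ 0 := (ENNReal.half_pos hε).ne'
  obtain ⟨N₁, K₁, hK₁c, hK₁s, hK₁d, hK₁μ⟩ := exists_disjoint_compact_pieces hE hμE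
    (W := fun i => V (e i)) (fun i => (hVc _).measurableSet) (by rwa [he.iUnion_comp]) hε2
  obtain ⟨d, hd, hgap⟩ := exists_gap_of_disjoint_compact (N := N₁) (fun i _ => hK₁c i)
    (fun i _ j _ hij => hK₁d hij)
  have hδ' : 0 < min δ (((1 + s) / 2 - l) * d / 2) :=
    lt_min hδ (half_pos (mul_pos (by linarith) hd))
  choose P B hP hB hPB using hV
  have hex := fun i => exists_folded_perturbation hnm hs0 hs1 (hP (e i)) ((hB (e i)).trans hls)
    (hPB (e i)) hδ'
  choose H S hHf hHL hSc hScov hT using hex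
  have hJ : ∀ p, ∃ j, ∀ i, p ∈ K₁ i → j = i := by
    intro p
    by_cases hp : ∃ j, p ∈ K₁ j
    · obtain ⟨j, hj⟩ := hp
      exact ⟨j, fun i hi => by_contra fun hji => Set.disjoint_left.1 (hK₁d hji) hj hi⟩
    · exact ⟨0, fun i hi => absurd ⟨i, hi⟩ hp⟩
  choose J hJ using hJ
  have hHJ : ∀ i, ∀ p ∈ K₁ i, H (J p) p = H i p := fun i p hp => by rw [hJ p i hp]
  obtain ⟨e₂, he₂⟩ := exists_surjective_nat (ℕ × (Fin n → ℤ × Bool))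
  have hE'm : MeasurableSet (⋃ i < N₁, K₁ i) :=
    MeasurableSet.iUnion fun i => MeasurableSet.iUnion fun _ => (hK₁c i).measurableSet
  have hE's : (⋃ i < N₁, K₁ i) ⊆ E := iUnion₂_subset fun i _ => (hK₁s i).trans inter_subset_left
  have hcov : (⋃ i < N₁, K₁ i) \ ⋃ a, K₁ (e₂ a).1 ∩ S (e₂ a).1 (e₂ a).2 = ∅ := by
    refine sdiff_eq_empty.2 (iUnion₂_subset fun i _ p hp => ?_)
    obtain ⟨κ, hκ⟩ := hScov i p
    obtain ⟨a, ha⟩ := he₂ (i, κ)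
    refine mem_iUnion.2 ⟨a, ?_⟩
    rw [ha]
    exact ⟨hp, hκ⟩
  obtain ⟨N, K, hKc, hKs, hKd, hKμ⟩ := exists_disjoint_compact_pieces hE'm
    (measure_ne_top_of_subset hE's hμE) (W := fun a => K₁ (e₂ a).1 ∩ S (e₂ a).1 (e₂ a).2)
    (fun a => ((hK₁c _).isClosed.inter (hSc _ _)).measurableSet) (by rw [hcov, measure_empty]) hε2
  refine ⟨N, K, fun p => H (J p) p, hKc, fun i => (hKs i).trans (inter_subset_left.trans hE's),
    hKd, ?_, fun p => (hHf _ p).trans (min_le_left _ _), ?_, fun i => ?_⟩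
  · calc μH[n] (E \ ⋃ i < N, K i)
        ≤ μH[n] ((E \ ⋃ i < N₁, K₁ i) ∪ ((⋃ i < N₁, K₁ i) \ ⋃ i < N, K i)) :=
          measure_mono (sdiff_triangle _ _ _)
      _ ≤ ε / 2 + ε / 2 := (measure_union_le _ _).trans (add_le_add hK₁μ hKμ)
      _ = ε := ENNReal.add_halves ε
  · have hmem : ∀ p ∈ ⋃ i < N, K i, ∃ i < N₁, p ∈ K₁ i := by
      intro p hp
      obtain ⟨i, _, hi⟩ := mem_iUnion₂.1 hp
      simpa using (hKs i hi).1
    intro p hp q hq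
    change ‖H (J p) p - H (J q) q‖ ≤ _
    obtain ⟨i, hi, hpi⟩ := hmem p hp
    obtain ⟨j, hj, hqj⟩ := hmem q hq
    by_cases hij : i = j
    · subst hij
      rw [hHJ i p hpi, hHJ i q hqj]
      exact hHL i p (hK₁s i hpi).2 q (hK₁s i hqj).2
    · have h1 := hgap i hi j hj hij p hpi q hqj
      have h2 := hf.dist_le_mul p q
      have h3 := (hHf (J p) p).trans (min_le_right _ _)
      have h4 := (hHf (J q) q).trans (min_le_right _ _)
      rw [dist_eq_norm] at h1
      rw [dist_eq_norm, dist_eq_norm] at h2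
      rw [← dist_eq_norm] at h2 h3 h4 ⊢
      rw [dist_comm] at h4
      have h5 := dist_triangle4 (H (J p) p) (f p) (f q) (H (J q) q)
      have h6 := mul_le_mul_of_nonneg_left h1 (show 0 ≤ (1 + s) / 2 - (l : ℝ) by linarith)
      linarith
  · obtain ⟨T, hT1, hTS⟩ := hT (e₂ i).1 (e₂ i).2
    refine ⟨T, hT1, fun p hp q hq => ?_⟩
    have hp' := (hKs i hp).2
    have hq' := (hKs i hq).2
    simp only [hHJ _ p hp'.1, hHJ _ q hq'.1]
    exact hTS p ⟨(hK₁s _ hp'.1).2, hp'.2⟩ q ⟨(hK₁s _ hq'.1).2, hq'.2⟩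

end Contracting

section GeneralPosition

theorem exists_pairwise_null_inter {X : Type*} [MeasurableSpace X] {μ : Measure X}
    {A : ℕ → ℝ → Set X} {N : ℕ} (hA : ∀ i < N, ∀ t, MeasurableSet (A i t))
    (hfin : ∀ i < N, ∀ t, μ (A i t) ≠ ∞) (hd : ∀ i, Pairwise (Function.onFun Disjoint (A i)))
    {τ : ℝ} (hτ : 0 < τ) :
    ∃ t : ℕ → ℝ, (∀ i, 0 < t i ∧ t i ≤ τ) ∧
      ∀ i < N, ∀ j < i, μ (A i (t i) ∩ A j (t j)) = 0 := by
  induction N with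
  | zero => exact ⟨fun _ => τ, fun _ => ⟨hτ, le_rfl⟩, fun i hi => absurd hi (Nat.not_lt_zero i)⟩
  | succ N ih =>
    obtain ⟨t, ht, htn⟩ := ih (fun i hi => hA i (hi.trans (Nat.lt_succ_self N)))
      fun i hi => hfin i (hi.trans (Nat.lt_succ_self N))
    have hbad : {x | ∃ j < N, 0 < μ.restrict (A j (t j)) (A N x)}.Countable := by
      have : {x | ∃ j < N, 0 < μ.restrict (A j (t j)) (A N x)} =
          ⋃ j ∈ Iio N, {x | 0 < μ.restrict (A j (t j)) (A N x)} := by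
        ext x
        simp
      rw [this]
      refine (to_countable _).biUnion fun j hj => ?_
      have hj' : μ (A j (t j)) ≠ ∞ := hfin j (lt_trans hj (Nat.lt_succ_self N)) _
      have : IsFiniteMeasure (μ.restrict (A j (t j))) := isFiniteMeasure_restrict.2 hj'
      exact Measure.countable_meas_pos_of_disjoint_of_meas_iUnion_ne_top _
        (fun x => hA N (Nat.lt_succ_self N) x) (hd N) (measure_ne_top _ _)
    obtain ⟨x, hx, hxτ⟩ := (hbad.dense_compl ℝ).exists_between hτ
    refine ⟨Function.update t N x, fun i => ?_, fun i hi j hj => ?_⟩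
    · rcases eq_or_ne i N with rfl | hi
      · rw [Function.update_self]
        exact ⟨hxτ.1, hxτ.2.le⟩
      · rw [Function.update_of_ne hi]
        exact ht i
    · rw [Function.update_of_ne (by omega : j ≠ N)]
      rcases eq_or_ne i N with rfl | hiN
      · rw [Function.update_self]
        have h0 : ¬ 0 < μ.restrict (A j (t j)) (A i x) := fun h => hx ⟨j, hj, h⟩
        rwa [not_lt, nonpos_iff_eq_zero, Measure.restrict_apply (hA i (Nat.lt_succ_self i) x)] at h0
      · rw [Function.update_of_ne hiN]
        exact htn i (by omega) j hj

/-- A contracting map on a rectifiable set of finite measure can be approximated by contractions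
which are nearly isometric on finitely many compact pieces of almost full measure, and which map
these pieces to disjoint sets. -/
theorem exists_disjoint_approximation {n m k : ℕ} (hnm : n < m) {E : Set (Euc k)}
    (hE : MeasurableSet E) (hμE : μH[n] E ≠ ∞) (hR : IsRectifiable n E) {f : Euc k → Euc m}
    {l : NNReal} (hf : LipschitzWith l f) {s : ℝ} (hls : l ≤ s) (hs0 : 1 / 2 < s) (hs1 : s < 1)
    {ε : ℝ≥0∞} (hε : ε ≠ 0) {δ : ℝ} (hδ : 0 < δ) :
    ∃ (N : ℕ) (K : ℕ → Set (Euc k)) (h : Euc k → Euc m), (∀ i, IsCompact (K i)) ∧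
      (∀ i, K i ⊆ E) ∧ Pairwise (Function.onFun Disjoint K) ∧ μH[n] (E \ ⋃ i < N, K i) ≤ ε ∧
      (∀ p, ‖h p - f p‖ ≤ δ) ∧ LipschitzOnWith 1 h (⋃ i < N, K i) ∧
      (∀ i < N, ∀ j < N, i ≠ j → Disjoint (h '' K i) (h '' K j)) ∧
      ∀ i, ∃ T : Euc m →L[ℝ] Euc n, ‖T‖ ≤ 1 ∧
        ∀ p ∈ K i, ∀ q ∈ K i, (2 * s - 1) * ‖p - q‖ ≤ ‖T (h p - h q)‖ := by
  have hε2 : ε / 2 ≠ 0 := (ENNReal.half_pos hε).ne'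
  obtain ⟨N, K, h, hKc, hKE, hKd, hKμ, hhf, hhL, hT⟩ := exists_contracting_approximation hnm hE
    hμE hR hf hls (by linarith) hs1 hε2 (half_pos hδ)
  choose T hT1 hTK using hT
  choose v hv1 hTv using fun i => exists_norm_eq_one_apply_eq_zero hnm (T i)
  obtain ⟨d, hd, hgap⟩ := exists_gap_of_disjoint_compact (N := N) (fun i _ => hKc i)
    (fun i _ j _ hij => hKd hij)
  have hτ : 0 < min (δ / 2) ((1 - s) / 2 * d / 2) :=
    lt_min (half_pos hδ) (half_pos (mul_pos (by linarith) hd))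
  have hmem : ∀ i < N, K i ⊆ ⋃ i < N, K i := fun i hi => subset_iUnion₂_of_subset i hi subset_rfl
  have hLip : ∀ i < N, ∀ t : ℝ, LipschitzOnWith 1 (fun p => h p + t • v i) (K i) := by
    intro i hi t
    refine LipschitzOnWith.of_dist_le_mul fun p hp q hq => ?_
    rw [dist_add_right, dist_eq_norm, dist_eq_norm, NNReal.coe_one]
    refine (hhL p (hmem i hi hp) q (hmem i hi hq)).trans ?_
    exact mul_le_mul_of_nonneg_right (by linarith) (norm_nonneg _)
  have hTinj : ∀ i, ∀ p ∈ K i, ∀ q ∈ K i, ∀ a b : ℝ,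
      (2 * s - 1) * ‖p - q‖ ≤ ‖(h p + a • v i) - (h q + b • v i)‖ := by
    intro i p hp q hq a b
    have h1 : T i ((h p + a • v i) - (h q + b • v i)) = T i (h p - h q) := by
      simp only [map_sub, map_add, map_smul, hTv, smul_zero, add_zero]
    refine (hTK i p hp q hq).trans ?_
    rw [← h1]
    exact ((T i).le_of_opNorm_le (hT1 i) _).trans_eq (one_mul _)
  obtain ⟨t, ht, htn⟩ := exists_pairwise_null_inter (μ := (μH[n] : Measure (Euc m)))
    (A := fun i x => (fun p => h p + x • v i) '' K i) (N := N)
    (fun i hi x => ((hKc i).image_of_continuousOn (hLip i hi x).continuousOn).measurableSet)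
    (fun i hi x => by
      refine ne_top_of_le_ne_top (measure_ne_top_of_subset (hKE i) hμE) ?_
      simpa using (hLip i hi x).hausdorffMeasure_image_le (Nat.cast_nonneg n))
    (fun i x y hxy => by
      refine Set.disjoint_left.2 ?_
      rintro _ ⟨p, hp, rfl⟩ ⟨q, hq, hpq⟩
      have h1 := hTinj i q hq p hp y x
      simp only at hpq
      rw [hpq, sub_self, norm_zero] at h1
      have h2 : ‖q - p‖ = 0 := le_antisymm (by nlinarith [norm_nonneg (q - p)]) (norm_nonneg _)
      rw [norm_eq_zero, sub_eq_zero] at h2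
      rw [h2] at hpq
      have hv0 : v i ≠ 0 := fun h0 => by simpa [h0] using hv1 i
      exact hxy (smul_left_injective ℝ hv0 (add_left_cancel hpq)).symm)
    hτ
  have hJ : ∀ p, ∃ j, ∀ i, p ∈ K i → j = i := by
    intro p
    by_cases hp : ∃ j, p ∈ K j
    · obtain ⟨j, hj⟩ := hp
      exact ⟨j, fun i hi => by_contra fun hji => Set.disjoint_left.1 (hKd hji) hj hi⟩
    · exact ⟨0, fun i hi => absurd ⟨i, hi⟩ hp⟩
  choose J hJ using hJ
  obtain ⟨g, hg⟩ : ∃ g : Euc k → Euc m, ∀ p, g p = h p + t (J p) • v (J p) := ⟨_, fun _ => rfl⟩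
  have hgJ : ∀ i, ∀ p ∈ K i, g p = h p + t i • v i := fun i p hp => by rw [hg, hJ p i hp]
  have hgh : ∀ p, ‖g p - h p‖ ≤ min (δ / 2) ((1 - s) / 2 * d / 2) := by
    intro p
    rw [hg, add_sub_cancel_left, norm_smul, hv1, mul_one, Real.norm_of_nonneg (ht _).1.le]
    exact (ht _).2
  have hgimage : ∀ i, g '' K i = (fun p => h p + t i • v i) '' K i := fun i =>
    image_congr (hgJ i)
  have hnull : ∀ i < N, ∀ j < N, i ≠ j → μH[n] (g '' K i ∩ g '' K j) = 0 := by
    intro i hi j hj hij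
    rw [hgimage, hgimage]
    rcases hij.lt_or_gt with h1 | h1
    · rw [inter_comm]
      exact htn j hj i h1
    · exact htn i hi j h1
  have hZ : ∀ i < N, ∀ j < N, i ≠ j → μH[n] (K i ∩ g ⁻¹' (g '' K j)) = 0 := by
    intro i hi j hj hij
    have h1 : (0 : ℝ) < 2 * s - 1 := by linarith
    have h2 := hausdorffMeasure_image_le_of_dist_le (f := (id : Euc k → Euc k)) (g := g)
      (s := K i ∩ g ⁻¹' (g '' K j)) (C := Real.toNNReal (2 * s - 1)⁻¹) (fun p hp q hq => by
        rw [Real.coe_toNNReal _ (inv_pos.2 h1).le, ← div_eq_inv_mul, le_div_iff₀ h1, mul_comm,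
          dist_eq_norm, dist_eq_norm, hgJ i p hp.1, hgJ i q hq.1]
        exact hTinj i p hp.1 q hq.1 _ _) n
    rw [image_id] at h2
    have h3 : g '' (K i ∩ g ⁻¹' (g '' K j)) ⊆ g '' K i ∩ g '' K j :=
      image_inter_preimage g (K i) (g '' K j) ▸ subset_rfl
    rw [measure_mono_null h3 (hnull i hi j hj hij), mul_zero] at h2
    exact le_antisymm h2 zero_le
  have hE'm : MeasurableSet (⋃ i < N, K i) :=
    MeasurableSet.iUnion fun i => MeasurableSet.iUnion fun _ => (hKc i).measurableSet
  have hE's : (⋃ i < N, K i) ⊆ E := iUnion₂_subset fun i _ => hKE i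
  obtain ⟨Z, hZdef⟩ : ∃ Z : ℕ → Set (Euc k), ∀ i, Z i =
    toMeasurable μH[n] (⋃ j ∈ {j | j < N ∧ i ≠ j}, K i ∩ g ⁻¹' (g '' K j)) := ⟨_, fun _ => rfl⟩
  have hZ0 : ∀ i < N, μH[n] (Z i) = 0 := by
    intro i hi
    rw [hZdef, measure_toMeasurable]
    exact (measure_biUnion_null_iff (to_countable _)).2 fun j hj => hZ i hi j hj.1 hj.2
  have hcov : μH[n] ((⋃ i < N, K i) \ ⋃ a, K a \ Z a) = 0 := by
    refine measure_mono_null (t := ⋃ i ∈ Iio N, Z i) ?_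
      ((measure_biUnion_null_iff (to_countable _)).2 hZ0)
    rintro p ⟨hp, hpn⟩
    obtain ⟨i, hi, hpi⟩ := mem_iUnion₂.1 hp
    exact mem_iUnion₂.2 ⟨i, hi, by_contra fun hpZ => hpn (mem_iUnion.2 ⟨i, hpi, hpZ⟩)⟩
  obtain ⟨N', K', hK'c, hK's, hK'd, hK'μ⟩ := exists_disjoint_compact_pieces hE'm
    (measure_ne_top_of_subset hE's hμE) (W := fun a => K a \ Z a)
    (fun a => (hKc a).measurableSet.diff (by rw [hZdef]; exact measurableSet_toMeasurable _ _))
    hcov hε2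
  have hK'N : ∀ i, ∀ p ∈ K' i, i < N := by
    intro i p hp
    obtain ⟨j, hj, hpj⟩ := mem_iUnion₂.1 (hK's i hp).1
    rwa [← hJ p i (hK's i hp).2.1, hJ p j hpj]
  refine ⟨N', K', g, hK'c, fun i => (hK's i).trans (inter_subset_left.trans hE's), hK'd, ?_,
    fun p => ?_, ?_, fun i _ j _ hij => ?_, fun i => ⟨T i, hT1 i, fun p hp q hq => ?_⟩⟩
  · calc μH[n] (E \ ⋃ i < N', K' i)
        ≤ μH[n] ((E \ ⋃ i < N, K i) ∪ ((⋃ i < N, K i) \ ⋃ i < N', K' i)) :=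
          measure_mono (sdiff_triangle _ _ _)
      _ ≤ ε / 2 + ε / 2 := (measure_union_le _ _).trans (add_le_add hKμ hK'μ)
      _ = ε := ENNReal.add_halves ε
  · have h1 := norm_sub_le_norm_sub_add_norm_sub (g p) (h p) (f p)
    have h2 := (hgh p).trans (min_le_left _ _)
    linarith [hhf p]
  · have hsub : (⋃ i < N', K' i) ⊆ ⋃ i < N, K i := iUnion₂_subset fun i _ =>
      (hK's i).trans inter_subset_left
    refine LipschitzOnWith.mono (LipschitzOnWith.of_dist_le_mul fun p hp q hq => ?_) hsub
    obtain ⟨i, hi, hpi⟩ := mem_iUnion₂.1 hp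
    obtain ⟨j, hj, hqj⟩ := mem_iUnion₂.1 hq
    have h0 := hhL p hp q hq
    by_cases hij : i = j
    · subst hij
      rw [hgJ i p hpi, hgJ i q hqj]
      exact (hLip i hi (t i)).dist_le_mul p hpi q hqj
    · have h1 := hgap i hi j hj hij p hpi q hqj
      have h3 := (hgh p).trans (min_le_right _ _)
      have h4 := (hgh q).trans (min_le_right _ _)
      rw [← dist_eq_norm] at h0 h3 h4
      rw [dist_comm] at h4
      rw [← dist_eq_norm] at h0
      have h5 := dist_triangle4 (g p) (h p) (h q) (g q)
      have h6 := mul_le_mul_of_nonneg_left h1 (show 0 ≤ (1 - s) / 2 by linarith)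
      rw [NNReal.coe_one]
      linarith
  · refine Set.disjoint_left.2 ?_
    rintro _ ⟨p, hp, rfl⟩ ⟨q, hq, hpq⟩
    have hp' := (hK's i hp).2
    refine hp'.2 ?_
    rw [hZdef]
    refine subset_toMeasurable _ _ (mem_iUnion₂.2 ⟨j, ⟨hK'N j q hq, hij⟩, hp'.1, ?_⟩)
    exact ⟨q, (hK's j hq).2.1, hpq⟩
  · have hp' := (hK's i hp).2.1
    have hq' := (hK's i hq).2.1
    rw [hgJ i p hp', hgJ i q hq', add_sub_add_right_eq_sub]
    exact hTK i p hp' q hq'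

end GeneralPosition

section Stability

/-- The measure of the image of a finite union of nearly isometric pieces with disjoint images is
lower semicontinuous along contractions. -/
theorem exists_pos_forall_le_hausdorffMeasure_image_iUnion {n m k : ℕ} {g : Euc k → Euc m} {N : ℕ}
    {K : ℕ → Set (Euc k)} (hK : ∀ i, IsCompact (K i)) (hg : LipschitzWith 1 g)
    (hd : ∀ i < N, ∀ j < N, i ≠ j → Disjoint (g '' K i) (g '' K j)) {θ : NNReal} (hθ0 : 0 < θ)
    (hT : ∀ i < N, ∃ T : Euc m →L[ℝ] Euc n, ‖T‖ ≤ 1 ∧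
      ∀ p ∈ K i, ∀ q ∈ K i, θ * ‖p - q‖ ≤ ‖T (g p - g q)‖) {ε : ℝ≥0∞} (hε : ε ≠ 0) :
    ∃ r > 0, ∀ G : Euc k → Euc m, LipschitzWith 1 G →
      (∀ p ∈ ⋃ i < N, K i, ‖G p - g p‖ ≤ r) →
        (θ : ℝ≥0∞) ^ n * μH[n] (⋃ i < N, K i) ≤ μH[n] (G '' ⋃ i < N, K i) + ε := by
  obtain ⟨e, he, hesum⟩ := ENNReal.exists_pos_sum_of_countable' hε ℕ
  have hR : ∀ i < N, ∃ r > 0, ∀ G : Euc k → Euc m, LipschitzOnWith 1 G (K i) →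
      (∀ x ∈ K i, ‖G x - g x‖ ≤ r) →
        (θ : ℝ≥0∞) ^ n * μH[n] (K i) ≤ μH[n] (G '' K i) + e i := by
    intro i hi
    obtain ⟨T, hT1, hTK⟩ := hT i hi
    exact exists_pos_forall_le_hausdorffMeasure_image (hK i) hg.lipschitzOnWith hT1 hθ0
      (fun p hp q hq => by rw [dist_eq_norm]; exact hTK p hp q hq) (he i).ne'
  choose! R hR0 hR using hR
  obtain ⟨d, hd0, hgap⟩ := exists_gap_of_disjoint_compact (K := fun i => g '' K i) (N := N)
    (fun i _ => (hK i).image hg.continuous) hd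
  have hr : ∀ᶠ r in 𝓝[>] (0 : ℝ), ∀ i ∈ Finset.range N, r ≤ R i := by
    refine (eventually_all_finset _).2 fun i hi => ?_
    filter_upwards [Ioo_mem_nhdsGT (hR0 i (Finset.mem_range.1 hi))] with r h using h.2.le
  obtain ⟨r, ⟨hrR, hrd⟩, hr0⟩ := ((hr.and (Ioo_mem_nhdsGT (show 0 < d / 2 by linarith))).and
    self_mem_nhdsWithin).exists
  refine ⟨r, hr0, fun G hG hGr => ?_⟩
  have hGK : ∀ i < N, ∀ p ∈ K i, ‖G p - g p‖ ≤ r := fun i hi p hp =>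
    hGr p (mem_iUnion₂.2 ⟨i, hi, hp⟩)
  have hdisj : (Finset.range N : Set ℕ).PairwiseDisjoint fun i => G '' K i := by
    intro i hi j hj hij
    simp only [Finset.coe_range, mem_Iio] at hi hj
    refine Set.disjoint_left.2 ?_
    rintro _ ⟨p, hp, rfl⟩ ⟨q, hq, hpq⟩
    have h1 := hgap i hi j hj hij _ (mem_image_of_mem g hp) _ (mem_image_of_mem g hq)
    have h2 := hGK i hi p hp
    have h3 := hGK j hj q hq
    rw [← dist_eq_norm] at h2 h3
    rw [hpq] at h3
    have h4 := dist_triangle_left (g p) (g q) (G p)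
    have h5 := hrd.2
    linarith
  have hrange : ∀ A : ℕ → Set (Euc k), (⋃ i < N, A i) = ⋃ i ∈ Finset.range N, A i := fun A => by
    simp only [Finset.mem_range]
  rw [hrange, image_iUnion₂, measure_biUnion_finset hdisj fun i _ =>
    ((hK i).image hG.continuous).measurableSet]
  calc (θ : ℝ≥0∞) ^ n * μH[n] (⋃ i ∈ Finset.range N, K i)
      ≤ (θ : ℝ≥0∞) ^ n * ∑ i ∈ Finset.range N, μH[n] (K i) := by
        gcongr
        exact measure_biUnion_finset_le _ _
    _ = ∑ i ∈ Finset.range N, (θ : ℝ≥0∞) ^ n * μH[n] (K i) := Finset.mul_sum _ _ _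
    _ ≤ ∑ i ∈ Finset.range N, (μH[n] (G '' K i) + e i) :=
        Finset.sum_le_sum fun i hi => by
          have hi' := Finset.mem_range.1 hi
          exact hR i hi' G hG.lipschitzOnWith fun x hx => (hGK i hi' x hx).trans (hrR i hi)
    _ ≤ _ := by
        rw [Finset.sum_add_distrib]
        gcongr
        exact (ENNReal.sum_le_tsum _).trans hesum.le

/-- A contraction defined on a set and close to a map `f` of Lipschitz constant `s < 1` extends to a
global contraction close to `f`. -/
theorem exists_lipschitzWith_one_extension_near {k m : ℕ} {f h : Euc k → Euc m} {A : Set (Euc k)}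
    {s : NNReal} (hf : LipschitzWith s f) (hh : LipschitzOnWith 1 h A) {δ ρ : ℝ}
    (hhf : ∀ p, ‖h p - f p‖ ≤ δ) (hs : s ≤ 1) (hδ : δ ≤ (1 - s) * ρ) (hρ : 0 ≤ ρ) :
    ∃ g : Euc k → Euc m, LipschitzWith 1 g ∧ EqOn g h A ∧ ∀ p, ‖g p - f p‖ ≤ 2 * ρ + δ := by
  classical
  have hs' : (s : ℝ) ≤ 1 := hs
  have hδ0 : 0 ≤ δ := (norm_nonneg _).trans (hhf 0)
  obtain ⟨Φ, hΦA, hΦf⟩ : ∃ Φ : Euc k → Euc m, (∀ p ∈ A, Φ p = h p) ∧ ∀ p ∉ A, Φ p = f p :=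
    ⟨fun p => if p ∈ A then h p else f p, fun p hp => if_pos hp, fun p hp => if_neg hp⟩
  have hf' : ∀ p q, dist (f p) (f q) ≤ s * dist p q := hf.dist_le_mul
  have hcross : ∀ p ∈ A, ∀ q, ρ ≤ dist q p → dist (h p) (f q) ≤ dist p q := by
    intro p hp q hq
    have h1 := hhf p
    rw [← dist_eq_norm] at h1
    rw [dist_comm q p] at hq
    nlinarith [dist_triangle (h p) (f p) (f q), hf' p q]
  have hΦ : LipschitzOnWith 1 Φ (A ∪ {p | ∀ q ∈ A, ρ ≤ dist p q}) := by
    refine LipschitzOnWith.of_dist_le_mul fun p hp q hq => ?_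
    rw [NNReal.coe_one, one_mul]
    by_cases hpA : p ∈ A <;> by_cases hqA : q ∈ A
    · rw [hΦA p hpA, hΦA q hqA]
      simpa using hh.dist_le_mul p hpA q hqA
    · rw [hΦA p hpA, hΦf q hqA]
      exact hcross p hpA q ((hq.resolve_left hqA) p hpA)
    · rw [hΦf p hpA, hΦA q hqA, dist_comm, dist_comm p q]
      exact hcross q hqA p ((hp.resolve_left hpA) q hqA)
    · rw [hΦf p hpA, hΦf q hqA]
      exact (hf' p q).trans (mul_le_of_le_one_left dist_nonneg hs')
  obtain ⟨g, hg, hgΦ⟩ := exists_lipschitzWith_one_extension Φ _ hΦ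
  have hgA : EqOn g h A := fun p hp => (hgΦ (Or.inl hp)).symm.trans (hΦA p hp)
  refine ⟨g, hg, hgA, fun p => ?_⟩
  by_cases hpA : p ∈ A
  · rw [hgA hpA]
    linarith [hhf p]
  by_cases hp : ∀ q ∈ A, ρ ≤ dist p q
  · rw [← hgΦ (Or.inr hp), hΦf p hpA, sub_self, norm_zero]
    positivity
  · push Not at hp
    obtain ⟨q, hq, hpq⟩ := hp
    have h1 := hg.dist_le_mul p q
    have h2 := hhf q
    rw [← dist_eq_norm] at h2 ⊢
    rw [← hgA hq] at h2
    rw [NNReal.coe_one, one_mul] at h1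
    have h3 := dist_triangle4 (g p) (g q) (f q) (f p)
    have h4 := hf' q p
    rw [dist_comm q p] at h4
    nlinarith [mul_le_mul_of_nonneg_right hs' (dist_nonneg (x := p) (y := q))]

end Stability

section LipschitzSpace

theorem LipE.exists_extension {m k : ℕ} {D : Set (Euc k)} (f : LipE 1 (↥D) m) :
    ∃ g : Euc k → Euc m, LipschitzWith 1 g ∧ ∀ x : D, g x = f.1 x := by
  classical
  have h0 : ∀ x : D, (if h : (x : Euc k) ∈ D then f.1 ⟨x, h⟩ else 0) = f.1 x := fun x =>
    dif_pos x.2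
  obtain ⟨g, hg, hgf⟩ := exists_lipschitzWith_one_extension
    (fun p => if h : p ∈ D then f.1 ⟨p, h⟩ else 0) D (LipschitzOnWith.of_dist_le_mul
      fun p hp q hq => by
        rw [h0 ⟨p, hp⟩, h0 ⟨q, hq⟩]
        exact f.2.dist_le_mul _ _)
  exact ⟨g, hg, fun x => (hgf x.2).symm.trans (h0 x)⟩

theorem LipE.image_eq {m k : ℕ} {D E : Set (Euc k)} (hED : E ⊆ D) {f : LipE 1 (↥D) m}
    {g : Euc k → Euc m} (hg : ∀ x : D, g x = f.1 x) :
    ⇑f.1 '' {x : ↥D | (x : Euc k) ∈ E} = g '' E := by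
  ext y
  constructor
  · rintro ⟨x, hx, rfl⟩
    exact ⟨x, hx, hg x⟩
  · rintro ⟨p, hp, rfl⟩
    exact ⟨⟨p, hED hp⟩, hp, (hg ⟨p, hED hp⟩).symm⟩

end LipschitzSpace

section Residual

theorem IsRectifiable.mono {n k : ℕ} {A E : Set (Euc k)} (hE : IsRectifiable n E) (hAE : A ⊆ E)
    (hA : MeasurableSet A) : IsRectifiable n A := by
  obtain ⟨-, F, f, K, hf, h0⟩ := hE
  exact ⟨hA.nullMeasurableSet, F, f, K, hf, measure_mono_null (sdiff_subset_sdiff_left hAE) h0⟩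

theorem exists_parameter_near_one {n : ℕ} {a ε : ℝ≥0∞} (ha : a ≠ ∞) (hε : ε ≠ 0) (M : ℝ) {η : ℝ}
    (hη : 0 < η) :
    ∃ s : ℝ, 1 / 2 < s ∧ s < 1 ∧ (1 - s) * M < η ∧ a ≤ ENNReal.ofReal (2 * s - 1) ^ n * a + ε := by
  have h1 : ∀ᶠ s in 𝓝[<] (1 : ℝ), 1 / 2 < s ∧ s < 1 := by
    filter_upwards [Ioo_mem_nhdsLT (show (1 / 2 : ℝ) < 1 by norm_num)] with s hs using hs
  have h2 : ∀ᶠ s in 𝓝[<] (1 : ℝ), (1 - s) * M < η := by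
    have : Continuous fun s : ℝ => (1 - s) * M := by fun_prop
    refine (this.tendsto 1).eventually (gt_mem_nhds ?_) |>.filter_mono nhdsWithin_le_nhds
    simpa using hη
  have h3 : ∀ᶠ s in 𝓝[<] (1 : ℝ), a ≤ ENNReal.ofReal (2 * s - 1) ^ n * a + ε := by
    have ht : Tendsto (fun s : ℝ => ENNReal.ofReal (2 * s - 1) ^ n * a + ε) (𝓝 1)
        (𝓝 (1 * a + ε)) := by
      refine Tendsto.add (ENNReal.Tendsto.mul_const ?_ (Or.inr ha)) tendsto_const_nhds
      have hc : Continuous fun s : ℝ => ENNReal.ofReal (2 * s - 1) ^ n :=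
        (ENNReal.continuous_pow n).comp (ENNReal.continuous_ofReal.comp (by fun_prop))
      have := hc.tendsto 1
      norm_num at this
      exact this
    refine (ht.eventually (lt_mem_nhds ?_)).filter_mono nhdsWithin_le_nhds |>.mono fun s h => h.le
    rw [one_mul]
    exact ENNReal.lt_add_right ha hε
  obtain ⟨s, ⟨hs, hs2⟩, hs3⟩ := ((h1.and h2).and h3).exists
  exact ⟨s, hs.1, hs.2, hs2, hs3⟩

theorem dense_interior_setOf_measure_le_image_add {n m k : ℕ} (hnm : n < m) {D E : Set (Euc k)}
    (hED : E ⊆ D) (hE : MeasurableSet E) (hμE : μH[n] E ≠ ∞) (hR : IsRectifiable n E) {ε : ℝ≥0∞}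
    (hε : ε ≠ 0) :
    Dense (interior {f : LipE 1 (↥D) m |
      μH[n] E ≤ μH[n] (⇑f.1 '' {x : ↥D | (x : Euc k) ∈ E}) + ε}) := by
  intro f₀
  rw [Metric.mem_closure_iff]
  intro η hη
  have hε3 : ε / 3 ≠ 0 := (ENNReal.div_pos hε (by norm_num)).ne'
  obtain ⟨s, hs0, hs1, hsM, hsμ⟩ := exists_parameter_near_one (n := n) hμE hε3 ‖f₀.1‖
    (show 0 < η / 4 by linarith)
  obtain ⟨F, hF, hFf⟩ := LipE.exists_extension f₀
  have hsc : ((Real.toNNReal s : NNReal) : ℝ) = s := Real.coe_toNNReal s (by linarith)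
  have hf : LipschitzWith (Real.toNNReal s) fun p => s • F p := by
    refine LipschitzWith.of_dist_le_mul fun p q => ?_
    rw [hsc, dist_smul₀, Real.norm_of_nonneg (by linarith)]
    refine mul_le_mul_of_nonneg_left ?_ (by linarith)
    simpa using hF.dist_le_mul p q
  obtain ⟨N, K, h, hKc, hKE, hKd, hKμ, hhf, hhL, hdisj, hT⟩ := exists_disjoint_approximation hnm
    hE hμE hR hf hsc.le hs0 hs1 hε3 (show 0 < (1 - s) * (η / 8) from
      mul_pos (by linarith) (by linarith))
  obtain ⟨g, hg, hgh, hgf⟩ := exists_lipschitzWith_one_extension_near (ρ := η / 8) hf hhL hhf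
    (Real.toNNReal_le_one.2 hs1.le) (by rw [hsc]) (by linarith)
  have hghi : ∀ i < N, EqOn g h (K i) := fun i hi =>
    hgh.mono (subset_iUnion₂_of_subset i hi subset_rfl)
  have hgf₀ : ∀ x : D, ‖g x - f₀.1 x‖ ≤ 3 * η / 4 := by
    intro x
    have h1 := hgf x
    have h2 : ‖s • F x - f₀.1 x‖ ≤ η / 4 := by
      have : s • F x - f₀.1 x = (s - 1) • f₀.1 x := by rw [hFf, sub_smul, one_smul]
      rw [this, norm_smul, Real.norm_of_nonpos (by linarith), neg_sub]
      exact (mul_le_mul_of_nonneg_left (f₀.1.norm_coe_le_norm x) (by linarith)).trans hsM.le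
    have h3 := norm_sub_le_norm_sub_add_norm_sub (g x) (s • F x) (f₀.1 x)
    nlinarith
  have hgb : ∀ x : D, ‖g x‖ ≤ 3 * η / 4 + ‖f₀.1‖ := fun x => by
    have h1 := norm_le_norm_sub_add (g x) (f₀.1 x)
    linarith [hgf₀ x, f₀.1.norm_coe_le_norm x]
  let G : LipE 1 (↥D) m := ⟨BoundedContinuousFunction.ofNormedAddCommGroup (fun x : D => g x)
    (hg.continuous.comp continuous_subtype_val) _ hgb, fun x y => hg x y⟩
  have hGg : ∀ x : D, G.1 x = g x := fun _ => rfl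
  refine ⟨G, ?_, ?_⟩
  · have hθ : (0 : ℝ) < 2 * s - 1 := by linarith
    obtain ⟨r, hr, hrG⟩ := exists_pos_forall_le_hausdorffMeasure_image_iUnion (n := n) (N := N)
      (θ := Real.toNNReal (2 * s - 1)) hKc hg (fun i hi j hj hij => by
        rw [(hghi i hi).image_eq, (hghi j hj).image_eq]
        exact hdisj i hi j hj hij) (Real.toNNReal_pos.2 hθ) (fun i hi => by
        obtain ⟨T, hT1, hTK⟩ := hT i
        refine ⟨T, hT1, fun p hp q hq => ?_⟩
        rw [Real.coe_toNNReal _ hθ.le, hghi i hi hp, hghi i hi hq]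
        exact hTK p hp q hq) hε3
    refine mem_interior.2 ⟨ball G r, fun G' hG' => ?_, isOpen_ball, mem_ball_self hr⟩
    obtain ⟨g', hg', hg'G⟩ := LipE.exists_extension G'
    have hKE' : (⋃ i < N, K i) ⊆ E := iUnion₂_subset fun i _ => hKE i
    have h1 := hrG g' hg' fun p hp => by
      have hpD : p ∈ D := hED (hKE' hp)
      rw [hg'G ⟨p, hpD⟩, ← hGg ⟨p, hpD⟩, ← dist_eq_norm]
      exact (BoundedContinuousFunction.dist_coe_le_dist _).trans (mem_ball.1 hG').le
    have hθ1 : ENNReal.ofReal (2 * s - 1) ^ n ≤ 1 :=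
      pow_le_one₀ zero_le (ENNReal.ofReal_le_one.2 (by linarith))
    have h2 : μH[n] E ≤ μH[n] (⋃ i < N, K i) + ε / 3 := by
      calc μH[n] E ≤ μH[n] ((⋃ i < N, K i) ∪ (E \ ⋃ i < N, K i)) :=
            measure_mono (by rw [union_sdiff_self]; exact subset_union_right)
        _ ≤ _ := (measure_union_le _ _).trans (add_le_add_right hKμ _)
    rw [mem_ofPred_eq, LipE.image_eq hED hg'G]
    calc μH[n] E ≤ ENNReal.ofReal (2 * s - 1) ^ n * μH[n] E + ε / 3 := hsμ
      _ ≤ ENNReal.ofReal (2 * s - 1) ^ n * (μH[n] (⋃ i < N, K i) + ε / 3) + ε / 3 := by gcongr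
      _ ≤ ENNReal.ofReal (2 * s - 1) ^ n * μH[n] (⋃ i < N, K i) + 1 * (ε / 3) + ε / 3 := by
          rw [mul_add]
          gcongr
      _ ≤ (μH[n] (g' '' ⋃ i < N, K i) + ε / 3) + 1 * (ε / 3) + ε / 3 := by
          gcongr
          exact h1
      _ ≤ (μH[n] (g' '' E) + ε / 3) + 1 * (ε / 3) + ε / 3 := by gcongr
      _ = μH[n] (g' '' E) + ε := by
          rw [one_mul, add_assoc, add_assoc, ← add_assoc (ε / 3), ENNReal.add_thirds]
  · rw [Subtype.dist_eq]
    refine ((BoundedContinuousFunction.dist_le (by linarith)).2 fun x => ?_).trans_lt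
      (show 3 * η / 4 < η by linarith)
    rw [dist_comm, dist_eq_norm, hGg]
    exact hgf₀ x

/-- A rectifiable set is exhausted, up to a null set, by an increasing sequence of measurable
rectifiable sets of finite measure. -/
theorem IsRectifiable.exists_monotone_exhaustion {n k : ℕ} {E : Set (Euc k)}
    (hE : IsRectifiable n E) :
    ∃ A : ℕ → Set (Euc k), Monotone A ∧ (∀ l, A l ⊆ E) ∧ (∀ l, MeasurableSet (A l)) ∧
      (∀ l, μH[n] (A l) ≠ ∞) ∧ μH[n] E = ⨆ l, μH[n] (A l) := by
  obtain ⟨φ, L, hφ, hφE⟩ := hE.exists_lipschitz_cover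
  obtain ⟨B, hBE, hB, hBae⟩ := hE.1.exists_measurable_subset_ae_eq
  obtain ⟨C, hC⟩ : ∃ C : ℕ → Set (Euc k), ∀ l, C l = ⋃ i ∈ Finset.range l,
    φ i '' closedBall 0 l := ⟨_, fun _ => rfl⟩
  have hCm : ∀ l, MeasurableSet (C l) := fun l => by
    rw [hC]
    exact Finset.measurableSet_biUnion _ fun i _ =>
      ((isCompact_closedBall _ _).image (hφ i).continuous).measurableSet
  have hCmono : Monotone C := fun a b hab => by
    rw [hC, hC]
    refine biUnion_mono (Finset.range_mono hab) fun i _ => image_mono ?_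
    exact closedBall_subset_closedBall (Nat.cast_le.2 hab)
  have hCfin : ∀ l, μH[n] (C l) ≠ ∞ := fun l => by
    rw [hC]
    refine ne_top_of_le_ne_top ?_ (measure_biUnion_finset_le _ _)
    refine ENNReal.sum_ne_top.2 fun i _ => ?_
    refine ne_top_of_le_ne_top ?_ ((hφ i).hausdorffMeasure_image_le (Nat.cast_nonneg n) _)
    refine ENNReal.mul_ne_top ?_ (isCompact_closedBall _ _).measure_ne_top
    exact ENNReal.rpow_ne_top_of_nonneg (Nat.cast_nonneg n) ENNReal.coe_ne_top
  have hmono : Monotone fun l => B ∩ C l := fun a b hab => inter_subset_inter_right _ (hCmono hab)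
  refine ⟨fun l => B ∩ C l, hmono, fun l => inter_subset_left.trans hBE,
    fun l => hB.inter (hCm l), fun l => measure_ne_top_of_subset inter_subset_right (hCfin l), ?_⟩
  rw [← hmono.measure_iUnion, ← inter_iUnion, ← measure_congr hBae]
  refine le_antisymm ?_ (measure_mono inter_subset_left)
  have hsub : B ⊆ (B ∩ ⋃ l, C l) ∪ (E \ ⋃ i, range (φ i)) := by
    intro p hp
    by_cases hpr : p ∈ ⋃ i, range (φ i)
    · obtain ⟨i, x, rfl⟩ := mem_iUnion.1 hpr
      obtain ⟨j, hj⟩ := exists_nat_ge ‖x‖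
      refine Or.inl ⟨hp, mem_iUnion.2 ⟨max (i + 1) j, ?_⟩⟩
      rw [hC]
      refine mem_iUnion₂.2 ⟨i, Finset.mem_range.2 (by omega), mem_image_of_mem _ ?_⟩
      rw [mem_closedBall_zero_iff]
      exact hj.trans (Nat.cast_le.2 (le_max_right _ _))
    · exact Or.inr ⟨hBE hp, hpr⟩
  refine (measure_mono hsub).trans ((measure_union_le _ _).trans_eq ?_)
  rw [hφE, add_zero]

end Residual

/-- For `n < m`, `n ≤ k`, an `n`-rectifiable set `E ⊆ ℝ^k` and any `D` with
`E ⊆ D ⊆ ℝ^k`, the set of `f ∈ Lip_1(D, ℝ^m)` with `H^n(f(E)) = H^n(E)` is residual in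
`Lip_1(D, ℝ^m)`. -/
theorem stmt1 (n m k : ℕ) (hnm : n < m) (hnk : n ≤ k)
    (E D : Set (Euc k)) (hED : E ⊆ D) (hE : IsRectifiable n E) :
    {f : LipE 1 (↥D) m |
        μH[n] (⇑f.1 '' {x : ↥D | (x : Euc k) ∈ E}) = μH[n] E}
      ∈ residual (LipE 1 (↥D) m) := by
  obtain ⟨A, -, hAE, hAm, hAfin, hAsup⟩ := hE.exists_monotone_exhaustion
  have hres : ∀ l j : ℕ, {f : LipE 1 (↥D) m |
      μH[n] (A l) ≤ μH[n] (⇑f.1 '' {x : ↥D | (x : Euc k) ∈ A l}) + (j : ℝ≥0∞)⁻¹} ∈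
        residual (LipE 1 (↥D) m) := fun l j =>
    mem_of_superset (residual_of_dense_open isOpen_interior
      (dense_interior_setOf_measure_le_image_add hnm ((hAE l).trans hED) (hAm l) (hAfin l)
        (hE.mono (hAE l) (hAm l)) (ENNReal.inv_ne_zero.2 (ENNReal.natCast_ne_top j))))
      interior_subset
  filter_upwards [eventually_countable_forall.2 fun l => eventually_countable_forall.2 (hres l)]
    with f hf
  obtain ⟨g, hg, hgf⟩ := LipE.exists_extension f
  rw [LipE.image_eq hED hgf]
  refine le_antisymm ?_ ?_
  · simpa using hg.hausdorffMeasure_image_le (Nat.cast_nonneg n) E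
  · rw [hAsup]
    refine iSup_le fun l => ENNReal.le_of_forall_pos_le_add fun ε hε _ => ?_
    obtain ⟨j, hj⟩ := ENNReal.exists_inv_nat_lt (ENNReal.coe_pos.2 hε).ne'
    have h1 : μH[n] (A l) ≤ μH[n] (⇑f.1 '' {x : ↥D | (x : Euc k) ∈ A l}) + (j : ℝ≥0∞)⁻¹ := hf l j
    rw [LipE.image_eq ((hAE l).trans hED) hgf] at h1
    exact h1.trans (add_le_add (measure_mono (image_mono (hAE l))) hj.le)
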